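/- arXiv:1906.11908 — 3 statements merged into one kernel-verified Lean document; each statement's English description precedes it below -/
import Mathlib

section
/- There exists a 4-regular matchstick graph with exactly 52 vertices; that is, there exist 52 distinct points in the Euclidean plane ℝ² and a set E of 104 unordered pairs of these points such that every pair in E consists of two points at Euclidean distance exactly 1, every point is an endpoint of exactly 4 pairs in E, and the closed line segments joining the endpoints of any two distinct pairs in E intersect at most in a common endpoint. -/
open scoped Classical

namespace Harb

theorem mul_bd {a b c d x y e f : ℝ} (h1 : a ≤ x) (h2 : x ≤ b) (h3 : c ≤ y) (h4 : y ≤ d)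
    (ha : 0 ≤ a) (hc : 0 ≤ c) (he : e ≤ a * c) (hf : b * d ≤ f) : e ≤ x * y ∧ x * y ≤ f :=
  ⟨he.trans (mul_le_mul h1 h3 hc (ha.trans h1)),
    (mul_le_mul h2 h4 (hc.trans h3) ((ha.trans h1).trans h2)).trans hf⟩

theorem sqrt_bd {a b x e f : ℝ} (h1 : a ≤ x) (h2 : x ≤ b) (_ : 0 ≤ e) (hf0 : 0 ≤ f)
    (he : e ^ 2 ≤ a) (hf : b ≤ f ^ 2) : e ≤ √x ∧ √x ≤ f :=
  ⟨Real.le_sqrt_of_sq_le (he.trans h1), Real.sqrt_le_iff.2 ⟨hf0, h2.trans hf⟩⟩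

theorem inv_bd {a b x e f : ℝ} (h1 : a ≤ x) (h2 : x ≤ b) (ha : 0 < a) (he : e * b ≤ 1)
    (hf : 1 ≤ f * a) : e ≤ x⁻¹ ∧ x⁻¹ ≤ f := by
  have hx : 0 < x := ha.trans_le h1
  have hb : 0 < b := hx.trans_le h2
  constructor
  · calc e ≤ b⁻¹ := by rw [← one_div, le_div_iff₀ hb]; exact he
      _ ≤ x⁻¹ := by gcongr
  · calc x⁻¹ ≤ a⁻¹ := by gcongr
      _ ≤ f := by rw [← one_div, div_le_iff₀ ha]; exact hf

noncomputable def sn (t : ℝ) : ℝ := √(1 - t * t)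
noncomputable def ax (t : ℝ) : ℝ := 5 / 2 * t - √3 * sn t / 2
noncomputable def ay (t : ℝ) : ℝ := √3 * t / 2 - 3 / 2 * sn t
noncomputable def AA (t : ℝ) : ℝ := ax t * ax t + ay t * ay t
noncomputable def qq (t : ℝ) : ℝ := √((AA t)⁻¹ - 1 / 4)
noncomputable def Nx (t : ℝ) : ℝ := 3 * t - ax t / 2 - qq t * ay t
noncomputable def Ny (t : ℝ) : ℝ := -2 * sn t + √3 * t - ay t / 2 + qq t * ax t
noncomputable def BB (t : ℝ) : ℝ := Nx t * Nx t + Ny t * Ny t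
noncomputable def al (t : ℝ) : ℝ := 3 / 4 * (BB t)⁻¹ + 1 / 4
noncomputable def be (t : ℝ) : ℝ := √((BB t)⁻¹ - al t * al t)
noncomputable def zx (t : ℝ) : ℝ := al t * Nx t - be t * Ny t
noncomputable def zy (t : ℝ) : ℝ := al t * Ny t + be t * Nx t
noncomputable def ff (t : ℝ) : ℝ := 4 * (√3 * zx t) - Ny t - √3 * Nx t

theorem bnd_lo (t : ℝ) (ht : (23/25) ≤ t ∧ t ≤ (23/25)) :
    ff t < 0 := by
  have hr : (17320507/10000000) ≤ √3 ∧ √3 ≤ (1732051/1000000) := by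
    exact sqrt_bd (le_refl 3) (le_refl 3) (by norm_num) (by norm_num) (by norm_num) (by norm_num)
  have htt : (8463999/10000000) ≤ t * t ∧ t * t ≤ (8464001/10000000) := by
    exact mul_bd ht.1 ht.2 ht.1 ht.2 (by norm_num) (by norm_num) (by norm_num) (by norm_num)
  have hs0 : (767999/5000000) ≤ (1 - t * t) ∧ (1 - t * t) ≤ (768001/5000000) := by
    constructor <;> linarith only [htt.1, htt.2]
  have hs : (195959/500000) ≤ sn t ∧ sn t ≤ (979797/2500000) := by
    unfold sn
    exact sqrt_bd hs0.1 hs0.2 (by norm_num) (by norm_num) (by norm_num) (by norm_num)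
  have hrs : (6788217/10000000) ≤ √3 * sn t ∧ √3 * sn t ≤ (1357647/2000000) := by
    exact mul_bd hr.1 hr.2 hs.1 hs.2 (by norm_num) (by norm_num) (by norm_num) (by norm_num)
  have hrt : (3186973/2000000) ≤ √3 * t ∧ √3 * t ≤ (15934871/10000000) := by
    exact mul_bd hr.1 hr.2 ht.1 ht.2 (by norm_num) (by norm_num) (by norm_num) (by norm_num)
  have hax : (19605881/10000000) ≤ ax t ∧ ax t ≤ (19605893/10000000) := by
    unfold ax
    constructor <;> linarith only [ht.1, ht.2, hrs.1, hrs.2]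
  have hay : (2088649/10000000) ≤ ay t ∧ ay t ≤ (2088667/10000000) := by
    unfold ay
    constructor <;> linarith only [hrt.1, hrt.2, hs.1, hs.2]
  have haxx : (7687811/2000000) ≤ ax t * ax t ∧ ax t * ax t ≤ (19219553/5000000) := by
    exact mul_bd hax.1 hax.2 hax.1 hax.2 (by norm_num) (by norm_num) (by norm_num) (by norm_num)
  have hayy : (109061/2500000) ≤ ay t * ay t ∧ ay t * ay t ≤ (218127/5000000) := by
    exact mul_bd hay.1 hay.2 hay.1 hay.2 (by norm_num) (by norm_num) (by norm_num) (by norm_num)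
  have hAA : (19437649/5000000) ≤ AA t ∧ AA t ≤ (38875361/10000000) := by
    unfold AA
    constructor <;> linarith only [haxx.1, haxx.2, hayy.1, hayy.2]
  have hiA : (1286161/5000000) ≤ (AA t)⁻¹ ∧ (AA t)⁻¹ ≤ (2572329/10000000) := by
    exact inv_bd hAA.1 hAA.2 (by norm_num) (by norm_num) (by norm_num)
  have hq0 : (72321/10000000) ≤ ((AA t)⁻¹ - 1/4) ∧ ((AA t)⁻¹ - 1/4) ≤ (7233/1000000) := by
    constructor <;> linarith only [hiA.1, hiA.2]
  have hq : (53151/625000) ≤ qq t ∧ qq t ≤ (106309/1250000) := by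
    unfold qq
    exact sqrt_bd hq0.1 hq0.2 (by norm_num) (by norm_num) (by norm_num) (by norm_num)
  have hqx : (833657/5000000) ≤ qq t * ax t ∧ qq t * ax t ≤ (416857/2500000) := by
    exact mul_bd hq.1 hq.2 hax.1 hax.2 (by norm_num) (by norm_num) (by norm_num) (by norm_num)
  have hqy : (177621/10000000) ≤ qq t * ay t ∧ qq t * ay t ≤ (177637/10000000) := by
    exact mul_bd hq.1 hq.2 hay.1 hay.2 (by norm_num) (by norm_num) (by norm_num) (by norm_num)
  have hNx : (3523883/2000000) ≤ Nx t ∧ Nx t ≤ (220243/125000) := by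
    unfold Nx
    constructor <;> linarith only [ht.1, ht.2, hax.1, hax.2, hqy.1, hqy.2]
  have hNy : (2179867/2500000) ≤ Ny t ∧ Ny t ≤ (68122/78125) := by
    unfold Ny
    constructor <;> linarith only [hs.1, hs.2, hrt.1, hrt.2, hay.1, hay.2, hqx.1, hqx.2]
  have hNxx : (31044377/10000000) ≤ Nx t * Nx t ∧ Nx t * Nx t ≤ (7761117/2500000) := by
    exact mul_bd hNx.1 hNx.2 hNx.1 hNx.2 (by norm_num) (by norm_num) (by norm_num) (by norm_num)
  have hNyy : (7602911/10000000) ≤ Ny t * Ny t ∧ Ny t * Ny t ≤ (1900793/2500000) := by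
    exact mul_bd hNy.1 hNy.2 hNy.1 hNy.2 (by norm_num) (by norm_num) (by norm_num) (by norm_num)
  have hBB : (38647287/10000000) ≤ BB t ∧ BB t ≤ (38647641/10000000) := by
    unfold BB
    constructor <;> linarith only [hNxx.1, hNxx.2, hNyy.1, hNyy.2]
  have hiB : (2587479/10000000) ≤ (BB t)⁻¹ ∧ (BB t)⁻¹ ≤ (517501/2000000) := by
    exact inv_bd hBB.1 hBB.2 (by norm_num) (by norm_num) (by norm_num)
  have hal : (138769/312500) ≤ al t ∧ al t ≤ (444063/1000000) := by
    unfold al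
    constructor <;> linarith only [hiB.1, hiB.2]
  have hall : (985949/5000000) ≤ al t * al t ∧ al t * al t ≤ (1971921/10000000) := by
    exact mul_bd hal.1 hal.2 hal.1 hal.2 (by norm_num) (by norm_num) (by norm_num) (by norm_num)
  have hb0 : (615557/10000000) ≤ ((BB t)⁻¹ - al t * al t) ∧ ((BB t)⁻¹ - al t * al t) ≤ (76951/1250000) := by
    constructor <;> linarith only [hiB.1, hiB.2, hall.1, hall.2]
  have hbe : (2481041/10000000) ≤ be t ∧ be t ≤ (1240573/5000000) := by
    unfold be
    exact sqrt_bd hb0.1 hb0.2 (by norm_num) (by norm_num) (by norm_num) (by norm_num)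
  have halx : (782409/1000000) ≤ al t * Nx t ∧ al t * Nx t ≤ (7824143/10000000) := by
    exact mul_bd hal.1 hal.2 hNx.1 hNx.2 (by norm_num) (by norm_num) (by norm_num) (by norm_num)
  have haly : (967993/2500000) ≤ al t * Ny t ∧ al t * Ny t ≤ (193603/500000) := by
    exact mul_bd hal.1 hal.2 hNy.1 hNy.2 (by norm_num) (by norm_num) (by norm_num) (by norm_num)
  have hbex : (546431/1250000) ≤ be t * Nx t ∧ be t * Nx t ≤ (2185821/5000000) := by
    exact mul_bd hbe.1 hbe.2 hNx.1 hNx.2 (by norm_num) (by norm_num) (by norm_num) (by norm_num)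
  have hbey : (1081667/5000000) ≤ be t * Ny t ∧ be t * Ny t ≤ (1081733/5000000) := by
    exact mul_bd hbe.1 hbe.2 hNy.1 hNy.2 (by norm_num) (by norm_num) (by norm_num) (by norm_num)
  have hzx : (5660623/10000000) ≤ zx t ∧ zx t ≤ (566081/1000000) := by
    unfold zx
    constructor <;> linarith only [halx.1, halx.2, hbey.1, hbey.2]
  have hzy : (8243419/10000000) ≤ zy t ∧ zy t ≤ (8243703/10000000) := by
    unfold zy
    constructor <;> linarith only [haly.1, haly.2, hbex.1, hbex.2]
  have hrzx : (1960897/2000000) ≤ √3 * zx t ∧ √3 * zx t ≤ (9804813/10000000) := by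
    exact mul_bd hr.1 hr.2 hzx.1 hzx.2 (by norm_num) (by norm_num) (by norm_num) (by norm_num)
  have hrNx : (30517719/10000000) ≤ √3 * Nx t ∧ √3 * Nx t ≤ (3051777/1000000) := by
    exact mul_bd hr.1 hr.2 hNx.1 hNx.2 (by norm_num) (by norm_num) (by norm_num) (by norm_num)
  unfold ff
  linarith only [hrzx.1, hrzx.2, hNy.1, hNy.2, hrNx.1, hrNx.2]

theorem bnd_hi (t : ℝ) (ht : (9201/10000) ≤ t ∧ t ≤ (9201/10000)) :
    0 < ff t := by
  have hr : (17320507/10000000) ≤ √3 ∧ √3 ≤ (1732051/1000000) := by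
    exact sqrt_bd (le_refl 3) (le_refl 3) (by norm_num) (by norm_num) (by norm_num) (by norm_num)
  have htt : (8465839/10000000) ≤ t * t ∧ t * t ≤ (4232921/5000000) := by
    exact mul_bd ht.1 ht.2 ht.1 ht.2 (by norm_num) (by norm_num) (by norm_num) (by norm_num)
  have hs0 : (1534157/10000000) ≤ (1 - t * t) ∧ (1 - t * t) ≤ (767081/5000000) := by
    constructor <;> linarith only [htt.1, htt.2]
  have hs : (391683/1000000) ≤ sn t ∧ sn t ≤ (97921/250000) := by
    unfold sn
    exact sqrt_bd hs0.1 hs0.2 (by norm_num) (by norm_num) (by norm_num) (by norm_num)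
  have hrs : (6784147/10000000) ≤ √3 * sn t ∧ √3 * sn t ≤ (848021/1250000) := by
    exact mul_bd hr.1 hr.2 hs.1 hs.2 (by norm_num) (by norm_num) (by norm_num) (by norm_num)
  have hrt : (15936597/10000000) ≤ √3 * t ∧ √3 * t ≤ (15936603/10000000) := by
    exact mul_bd hr.1 hr.2 ht.1 ht.2 (by norm_num) (by norm_num) (by norm_num) (by norm_num)
  have hax : (3922083/2000000) ≤ ax t ∧ ax t ≤ (4902607/2500000) := by
    unfold ax
    constructor <;> linarith only [ht.1, ht.2, hrs.1, hrs.2]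
  have hay : (2093037/10000000) ≤ ay t ∧ ay t ≤ (1046529/5000000) := by
    unfold ay
    constructor <;> linarith only [hrt.1, hrt.2, hs.1, hs.2]
  have haxx : (9614209/2500000) ≤ ax t * ax t ∧ ax t * ax t ≤ (3845689/1000000) := by
    exact mul_bd hax.1 hax.2 hax.1 hax.2 (by norm_num) (by norm_num) (by norm_num) (by norm_num)
  have hayy : (438079/10000000) ≤ ay t * ay t ∧ ay t * ay t ≤ (438091/10000000) := by
    exact mul_bd hay.1 hay.2 hay.1 hay.2 (by norm_num) (by norm_num) (by norm_num) (by norm_num)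
  have hAA : (19447457/5000000) ≤ AA t ∧ AA t ≤ (19447491/5000000) := by
    unfold AA
    constructor <;> linarith only [haxx.1, haxx.2, hayy.1, hayy.2]
  have hiA : (160689/625000) ≤ (AA t)⁻¹ ∧ (AA t)⁻¹ ≤ (321379/1250000) := by
    exact inv_bd hAA.1 hAA.2 (by norm_num) (by norm_num) (by norm_num)
  have hq0 : (71023/10000000) ≤ ((AA t)⁻¹ - 1/4) ∧ ((AA t)⁻¹ - 1/4) ≤ (71033/10000000) := by
    constructor <;> linarith only [hiA.1, hiA.2]
  have hq : (3371/40000) ≤ qq t ∧ qq t ≤ (210703/2500000) := by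
    unfold qq
    exact sqrt_bd hq0.1 hq0.2 (by norm_num) (by norm_num) (by norm_num) (by norm_num)
  have hqx : (826333/5000000) ≤ qq t * ax t ∧ qq t * ax t ≤ (206599/1250000) := by
    exact mul_bd hq.1 hq.2 hax.1 hax.2 (by norm_num) (by norm_num) (by norm_num) (by norm_num)
  have hqy : (176389/10000000) ≤ qq t * ay t ∧ qq t * ay t ≤ (176407/10000000) := by
    exact mul_bd hq.1 hq.2 hay.1 hay.2 (by norm_num) (by norm_num) (by norm_num) (by norm_num)
  have hNx : (8810689/5000000) ≤ Nx t ∧ Nx t ≤ (3524281/2000000) := by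
    unfold Nx
    constructor <;> linarith only [ht.1, ht.2, hax.1, hax.2, hqy.1, hqy.2]
  have hNy : (8709053/10000000) ≤ Ny t ∧ Ny t ≤ (4354609/5000000) := by
    unfold Ny
    constructor <;> linarith only [hs.1, hs.2, hrt.1, hrt.2, hay.1, hay.2, hqx.1, hqx.2]
  have hNxx : (6210259/2000000) ≤ Nx t * Nx t ∧ Nx t * Nx t ≤ (31051393/10000000) := by
    exact mul_bd hNx.1 hNx.2 hNx.1 hNx.2 (by norm_num) (by norm_num) (by norm_num) (by norm_num)
  have hNyy : (7584759/10000000) ≤ Ny t * Ny t ∧ Ny t * Ny t ≤ (7585049/10000000) := by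
    exact mul_bd hNy.1 hNy.2 hNy.1 hNy.2 (by norm_num) (by norm_num) (by norm_num) (by norm_num)
  have hBB : (38636053/10000000) ≤ BB t ∧ BB t ≤ (38636443/10000000) := by
    unfold BB
    constructor <;> linarith only [hNxx.1, hNxx.2, hNyy.1, hNyy.2]
  have hiB : (647057/2500000) ≤ (BB t)⁻¹ ∧ (BB t)⁻¹ ≤ (1294129/5000000) := by
    exact inv_bd hBB.1 hBB.2 (by norm_num) (by norm_num) (by norm_num)
  have hal : (444117/1000000) ≤ al t ∧ al t ≤ (888239/2000000) := by
    unfold al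
    constructor <;> linarith only [hiB.1, hiB.2]
  have hall : (986199/5000000) ≤ al t * al t ∧ al t * al t ≤ (1972423/10000000) := by
    exact mul_bd hal.1 hal.2 hal.1 hal.2 (by norm_num) (by norm_num) (by norm_num) (by norm_num)
  have hb0 : (153951/2500000) ≤ ((BB t)⁻¹ - al t * al t) ∧ ((BB t)⁻¹ - al t * al t) ≤ (615861/10000000) := by
    constructor <;> linarith only [hiB.1, hiB.2, hall.1, hall.2]
  have hbe : (1240769/5000000) ≤ be t ∧ be t ≤ (310207/1250000) := by
    unfold be
    exact sqrt_bd hb0.1 hb0.2 (by norm_num) (by norm_num) (by norm_num) (by norm_num)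
  have halx : (244561/312500) ≤ al t * Nx t ∧ al t * Nx t ≤ (7826011/10000000) := by
    exact mul_bd hal.1 hal.2 hNx.1 hNx.2 (by norm_num) (by norm_num) (by norm_num) (by norm_num)
  have haly : (3867837/10000000) ≤ al t * Ny t ∧ al t * Ny t ≤ (773587/2000000) := by
    exact mul_bd hal.1 hal.2 hNy.1 hNy.2 (by norm_num) (by norm_num) (by norm_num) (by norm_num)
  have hbex : (437281/1000000) ≤ be t * Nx t ∧ be t * Nx t ≤ (1093257/2500000) := by
    exact mul_bd hbe.1 hbe.2 hNx.1 hNx.2 (by norm_num) (by norm_num) (by norm_num) (by norm_num)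
  have hbey : (2161183/10000000) ≤ be t * Ny t ∧ be t * Ny t ≤ (216133/1000000) := by
    exact mul_bd hbe.1 hbe.2 hNy.1 hNy.2 (by norm_num) (by norm_num) (by norm_num) (by norm_num)
  have hzx : (5664621/10000000) ≤ zx t ∧ zx t ≤ (5664829/10000000) := by
    unfold zx
    constructor <;> linarith only [halx.1, halx.2, hbey.1, hbey.2]
  have hzy : (4120323/5000000) ≤ zy t ∧ zy t ≤ (2060241/2500000) := by
    unfold zy
    constructor <;> linarith only [haly.1, haly.2, hbex.1, hbex.2]
  have hrzx : (9811409/10000000) ≤ √3 * zx t ∧ √3 * zx t ≤ (4905887/5000000) := by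
    exact mul_bd hr.1 hr.2 hzx.1 hzx.2 (by norm_num) (by norm_num) (by norm_num) (by norm_num)
  have hrNx : (30521119/10000000) ≤ √3 * Nx t ∧ √3 * Nx t ≤ (15260587/5000000) := by
    exact mul_bd hr.1 hr.2 hNx.1 hNx.2 (by norm_num) (by norm_num) (by norm_num) (by norm_num)
  unfold ff
  linarith only [hrzx.1, hrzx.2, hNy.1, hNy.2, hrNx.1, hrNx.2]

theorem bnd_mid (t : ℝ) (ht : (23/25) ≤ t ∧ t ≤ (9201/10000)) :
    ((17320507/10000000) ≤ √3 ∧ √3 ≤ (1732051/1000000)) ∧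
    ((391683/1000000) ≤ sn t ∧ sn t ≤ (979797/2500000)) ∧
    ((704671/400000) ≤ Nx t ∧ Nx t ≤ (8812021/5000000)) ∧
    ((8702243/10000000) ≤ Ny t ∧ Ny t ≤ (8726433/10000000)) ∧
    ((5648449/10000000) ≤ zx t ∧ zx t ≤ (1419249/2500000)) ∧
    ((8220959/10000000) ≤ zy t ∧ zy t ≤ (413169/500000)) ∧ 0 < AA t ∧ 0 < BB t ∧ 0 < (AA t)⁻¹ - 1/4 ∧ 0 < (BB t)⁻¹ - al t * al t := by
  have hr : (17320507/10000000) ≤ √3 ∧ √3 ≤ (1732051/1000000) := by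
    exact sqrt_bd (le_refl 3) (le_refl 3) (by norm_num) (by norm_num) (by norm_num) (by norm_num)
  have htt : (8463999/10000000) ≤ t * t ∧ t * t ≤ (4232921/5000000) := by
    exact mul_bd ht.1 ht.2 ht.1 ht.2 (by norm_num) (by norm_num) (by norm_num) (by norm_num)
  have hs0 : (1534157/10000000) ≤ (1 - t * t) ∧ (1 - t * t) ≤ (768001/5000000) := by
    constructor <;> linarith only [htt.1, htt.2]
  have hs : (391683/1000000) ≤ sn t ∧ sn t ≤ (979797/2500000) := by
    unfold sn
    exact sqrt_bd hs0.1 hs0.2 (by norm_num) (by norm_num) (by norm_num) (by norm_num)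
  have hrs : (6784147/10000000) ≤ √3 * sn t ∧ √3 * sn t ≤ (1357647/2000000) := by
    exact mul_bd hr.1 hr.2 hs.1 hs.2 (by norm_num) (by norm_num) (by norm_num) (by norm_num)
  have hrt : (3186973/2000000) ≤ √3 * t ∧ √3 * t ≤ (15936603/10000000) := by
    exact mul_bd hr.1 hr.2 ht.1 ht.2 (by norm_num) (by norm_num) (by norm_num) (by norm_num)
  have hax : (19605881/10000000) ≤ ax t ∧ ax t ≤ (4902607/2500000) := by
    unfold ax
    constructor <;> linarith only [ht.1, ht.2, hrs.1, hrs.2]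
  have hay : (2088649/10000000) ≤ ay t ∧ ay t ≤ (1046529/5000000) := by
    unfold ay
    constructor <;> linarith only [hrt.1, hrt.2, hs.1, hs.2]
  have haxx : (7687811/2000000) ≤ ax t * ax t ∧ ax t * ax t ≤ (3845689/1000000) := by
    exact mul_bd hax.1 hax.2 hax.1 hax.2 (by norm_num) (by norm_num) (by norm_num) (by norm_num)
  have hayy : (109061/2500000) ≤ ay t * ay t ∧ ay t * ay t ≤ (438091/10000000) := by
    exact mul_bd hay.1 hay.2 hay.1 hay.2 (by norm_num) (by norm_num) (by norm_num) (by norm_num)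
  have hAA : (19437649/5000000) ≤ AA t ∧ AA t ≤ (19447491/5000000) := by
    unfold AA
    constructor <;> linarith only [haxx.1, haxx.2, hayy.1, hayy.2]
  have hiA : (160689/625000) ≤ (AA t)⁻¹ ∧ (AA t)⁻¹ ≤ (2572329/10000000) := by
    exact inv_bd hAA.1 hAA.2 (by norm_num) (by norm_num) (by norm_num)
  have hq0 : (71023/10000000) ≤ ((AA t)⁻¹ - 1/4) ∧ ((AA t)⁻¹ - 1/4) ≤ (7233/1000000) := by
    constructor <;> linarith only [hiA.1, hiA.2]
  have hq : (3371/40000) ≤ qq t ∧ qq t ≤ (106309/1250000) := by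
    unfold qq
    exact sqrt_bd hq0.1 hq0.2 (by norm_num) (by norm_num) (by norm_num) (by norm_num)
  have hqx : (413071/2500000) ≤ qq t * ax t ∧ qq t * ax t ≤ (1667813/10000000) := by
    exact mul_bd hq.1 hq.2 hax.1 hax.2 (by norm_num) (by norm_num) (by norm_num) (by norm_num)
  have hqy : (176019/10000000) ≤ qq t * ay t ∧ qq t * ay t ≤ (17801/1000000) := by
    exact mul_bd hq.1 hq.2 hay.1 hay.2 (by norm_num) (by norm_num) (by norm_num) (by norm_num)
  have hNx : (704671/400000) ≤ Nx t ∧ Nx t ≤ (8812021/5000000) := by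
    unfold Nx
    constructor <;> linarith only [ht.1, ht.2, hax.1, hax.2, hqy.1, hqy.2]
  have hNy : (8702243/10000000) ≤ Ny t ∧ Ny t ≤ (8726433/10000000) := by
    unfold Ny
    constructor <;> linarith only [hs.1, hs.2, hrt.1, hrt.2, hay.1, hay.2, hqx.1, hqx.2]
  have hNxx : (1241403/400000) ≤ Nx t * Nx t ∧ Nx t * Nx t ≤ (31060687/10000000) := by
    exact mul_bd hNx.1 hNx.2 hNx.1 hNx.2 (by norm_num) (by norm_num) (by norm_num) (by norm_num)
  have hNyy : (3786451/5000000) ≤ Ny t * Ny t ∧ Ny t * Ny t ≤ (1523013/2000000) := by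
    exact mul_bd hNy.1 hNy.2 hNy.1 hNy.2 (by norm_num) (by norm_num) (by norm_num) (by norm_num)
  have hBB : (4825997/1250000) ≤ BB t ∧ BB t ≤ (38675753/10000000) := by
    unfold BB
    constructor <;> linarith only [hNxx.1, hNxx.2, hNyy.1, hNyy.2]
  have hiB : (1292799/5000000) ≤ (BB t)⁻¹ ∧ (BB t)⁻¹ ≤ (129507/500000) := by
    exact inv_bd hBB.1 hBB.2 (by norm_num) (by norm_num) (by norm_num)
  have hal : (4439197/10000000) ≤ al t ∧ al t ≤ (2221303/5000000) := by
    unfold al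
    constructor <;> linarith only [hiB.1, hiB.2]
  have hall : (985323/5000000) ≤ al t * al t ∧ al t * al t ≤ (493419/2500000) := by
    exact mul_bd hal.1 hal.2 hal.1 hal.2 (by norm_num) (by norm_num) (by norm_num) (by norm_num)
  have hb0 : (611921/10000000) ≤ ((BB t)⁻¹ - al t * al t) ∧ ((BB t)⁻¹ - al t * al t) ≤ (123899/2000000) := by
    constructor <;> linarith only [hiB.1, hiB.2, hall.1, hall.2]
  have hbe : (1236851/5000000) ≤ be t ∧ be t ≤ (2488967/10000000) := by
    unfold be
    exact sqrt_bd hb0.1 hb0.2 (by norm_num) (by norm_num) (by norm_num) (by norm_num)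
  have halx : (488777/625000) ≤ al t * Nx t ∧ al t * Nx t ≤ (7829669/10000000) := by
    exact mul_bd hal.1 hal.2 hNx.1 hNx.2 (by norm_num) (by norm_num) (by norm_num) (by norm_num)
  have haly : (482887/1250000) ≤ al t * Ny t ∧ al t * Ny t ≤ (969203/2500000) := by
    exact mul_bd hal.1 hal.2 hNy.1 hNy.2 (by norm_num) (by norm_num) (by norm_num) (by norm_num)
  have hbex : (544733/1250000) ≤ be t * Nx t ∧ be t * Nx t ≤ (4386567/10000000) := by
    exact mul_bd hbe.1 hbe.2 hNx.1 hNx.2 (by norm_num) (by norm_num) (by norm_num) (by norm_num)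
  have hbey : (1076337/5000000) ≤ be t * Ny t ∧ be t * Ny t ≤ (1085991/5000000) := by
    exact mul_bd hbe.1 hbe.2 hNy.1 hNy.2 (by norm_num) (by norm_num) (by norm_num) (by norm_num)
  have hzx : (5648449/10000000) ≤ zx t ∧ zx t ≤ (1419249/2500000) := by
    unfold zx
    constructor <;> linarith only [halx.1, halx.2, hbey.1, hbey.2]
  have hzy : (8220959/10000000) ≤ zy t ∧ zy t ≤ (413169/500000) := by
    unfold zy
    constructor <;> linarith only [haly.1, haly.2, hbex.1, hbex.2]
  have hrzx : (9783399/10000000) ≤ √3 * zx t ∧ √3 * zx t ≤ (614553/625000) := by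
    exact mul_bd hr.1 hr.2 hzx.1 hzx.2 (by norm_num) (by norm_num) (by norm_num) (by norm_num)
  have hrNx : (15256573/5000000) ≤ √3 * Nx t ∧ √3 * Nx t ≤ (30525741/10000000) := by
    exact mul_bd hr.1 hr.2 hNx.1 hNx.2 (by norm_num) (by norm_num) (by norm_num) (by norm_num)
  exact ⟨hr, hs, hNx, hNy, hzx, hzy, by linarith only [hAA.1], by linarith only [hBB.1], by linarith only [hq0.1], by linarith only [hb0.1]⟩


theorem core : ∃ r c s u v x y : ℝ, r ^ 2 = 3 ∧ c ^ 2 + s ^ 2 = 1 ∧ x ^ 2 + y ^ 2 = 1 ∧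
    (u - 2 * x) ^ 2 + (v - 2 * y) ^ 2 = 1 ∧ 4 * (r * x) = v + r * u ∧
    (3 * c - u) ^ 2 + (-3 * s - v + (s + r * c)) ^ 2 = 1 ∧
    (c - u - (c - r * s) / 2) ^ 2 + (-s - v + (s + r * c) / 2) ^ 2 = 1 ∧
    (1.732 ≤ r ∧ r ≤ 1.7321) ∧ (0.92 ≤ c ∧ c ≤ 0.9201) ∧ (0.3915 ≤ s ∧ s ≤ 0.392) ∧
    (1.761 ≤ u ∧ u ≤ 1.763) ∧ (0.870 ≤ v ∧ v ≤ 0.873) ∧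
    (0.563 ≤ x ∧ x ≤ 0.569) ∧ (0.821 ≤ y ∧ y ≤ 0.827) := by
  have hcont : ContinuousOn ff (Set.Icc (92 / 100) (9201 / 10000)) := by
    have hA : ∀ t ∈ Set.Icc (92 / 100 : ℝ) (9201 / 10000), AA t ≠ 0 := fun t ht =>
      (bnd_mid t ⟨by linarith [ht.1], by linarith [ht.2]⟩).2.2.2.2.2.2.1.ne'
    have hB : ∀ t ∈ Set.Icc (92 / 100 : ℝ) (9201 / 10000), BB t ≠ 0 := fun t ht =>
      (bnd_mid t ⟨by linarith [ht.1], by linarith [ht.2]⟩).2.2.2.2.2.2.2.1.ne'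
    have c1 : Continuous sn := by unfold sn; fun_prop
    have c2 : Continuous ax := by unfold ax; fun_prop
    have c3 : Continuous ay := by unfold ay; fun_prop
    have c4 : Continuous AA := by unfold AA; fun_prop
    have c5 : ContinuousOn qq (Set.Icc (92 / 100) (9201 / 10000)) :=
      ((c4.continuousOn.inv₀ hA).sub continuousOn_const).sqrt
    have c6 : ContinuousOn Nx (Set.Icc (92 / 100) (9201 / 10000)) := by unfold Nx; fun_prop
    have c7 : ContinuousOn Ny (Set.Icc (92 / 100) (9201 / 10000)) := by unfold Ny; fun_prop
    have c8 : ContinuousOn BB (Set.Icc (92 / 100) (9201 / 10000)) := by unfold BB; fun_prop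
    have c9 : ContinuousOn (fun t => (BB t)⁻¹) (Set.Icc (92 / 100) (9201 / 10000)) := c8.inv₀ hB
    have c10 : ContinuousOn al (Set.Icc (92 / 100) (9201 / 10000)) := by unfold al; fun_prop
    have c11 : ContinuousOn be (Set.Icc (92 / 100) (9201 / 10000)) :=
      (c9.sub (c10.mul c10)).sqrt
    have c12 : ContinuousOn zx (Set.Icc (92 / 100) (9201 / 10000)) := by unfold zx; fun_prop
    unfold ff
    fun_prop
  have hlo := bnd_lo (92 / 100) ⟨by norm_num, by norm_num⟩
  have hhi := bnd_hi (9201 / 10000) ⟨by norm_num, by norm_num⟩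
  obtain ⟨t, ht, hf⟩ := intermediate_value_Icc (by norm_num) hcont ⟨hlo.le, hhi.le⟩
  obtain ⟨h1, h2⟩ := ht
  obtain ⟨br, bs, bu, bv, bx, by', pA, pB, pq, pb⟩ :=
    bnd_mid t ⟨by linarith, by linarith⟩
  have hr : √3 ^ 2 = (3 : ℝ) := Real.sq_sqrt (by norm_num)
  have hs : t ^ 2 + sn t ^ 2 = 1 := by
    unfold sn
    rw [Real.sq_sqrt (by nlinarith)]; ring
  have hq : qq t ^ 2 * AA t = 1 - AA t / 4 := by
    unfold qq
    rw [Real.sq_sqrt pq.le]; field_simp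
  have hb : be t ^ 2 * BB t = 1 - al t ^ 2 * BB t := by
    unfold be
    rw [Real.sq_sqrt pb.le]; field_simp
  have ha : 4 * al t * BB t = 3 + BB t := by
    unfold al
    field_simp
  have hAA : AA t = ax t * ax t + ay t * ay t := rfl
  have hBB : BB t = Nx t * Nx t + Ny t * Ny t := rfl
  have hz : zx t ^ 2 + zy t ^ 2 = 1 := by
    have : zx t ^ 2 + zy t ^ 2 = (al t ^ 2 + be t ^ 2) * BB t := by
      rw [hBB]; unfold zx zy; ring
    rw [this]; linarith
  have hdot : zx t * Nx t + zy t * Ny t = al t * BB t := by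
    rw [hBB]; unfold zx zy; ring
  refine ⟨√3, t, sn t, Nx t, Ny t, zx t, zy t, hr, hs, hz, ?_, ?_, ?_, ?_, ?_, ?_, ?_, ?_, ?_, ?_, ?_⟩
  · linear_combination 4 * hz - 4 * hdot - hBB - ha
  · unfold ff at hf; linarith
  · have e : (3 * t - Nx t) ^ 2 + (-3 * sn t - Ny t + (sn t + √3 * t)) ^ 2
        = AA t / 4 + qq t ^ 2 * AA t := by
      rw [hAA]; unfold Nx Ny; ring
    rw [e]; linarith
  · have e : (t - Nx t - (t - √3 * sn t) / 2) ^ 2 + (-sn t - Ny t + (sn t + √3 * t) / 2) ^ 2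
        = AA t / 4 + qq t ^ 2 * AA t := by
      have e1 : t - Nx t - (t - √3 * sn t) / 2 = - ax t / 2 + qq t * ay t := by
        unfold Nx; linarith [show ax t = 5 / 2 * t - √3 * sn t / 2 from rfl]
      have e2 : -sn t - Ny t + (sn t + √3 * t) / 2 = - ay t / 2 - qq t * ax t := by
        unfold Ny; linarith [show ay t = √3 * t / 2 - 3 / 2 * sn t from rfl]
      rw [e1, e2, hAA]; ring
    rw [e]; linarith
  all_goals
    clear hcont hlo hhi hf hr hs hq hb ha hAA hBB hz hdot pA pB pq pb
    constructor <;> linarith [br.1, br.2, bs.1, bs.2, bu.1, bu.2, bv.1, bv.2, bx.1, bx.2, by'.1, by'.2]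

/-! Combinatorial data. -/

def EL : List (Fin 52 × Fin 52) := [(0, 1), (0, 2), (1, 3), (2, 4), (0, 5), (1, 5), (0, 6), (2, 6), (3, 7), (4, 8), (1, 9), (3, 9), (5, 9), (2, 10), (4, 10), (6, 10), (3, 11), (7, 11), (9, 11), (4, 12), (8, 12), (10, 12), (5, 13), (6, 13), (7, 14), (8, 15), (11, 16), (13, 16), (12, 17), (13, 17), (7, 18), (14, 18), (8, 19), (15, 19), (14, 20), (16, 20), (15, 21), (17, 21), (14, 22), (18, 22), (20, 22), (15, 23), (19, 23), (21, 23), (18, 24), (22, 24), (16, 25), (20, 25), (17, 26), (21, 26), (19, 27), (23, 27), (24, 28), (27, 29), (25, 30), (28, 30), (26, 31), (29, 31), (24, 32), (28, 32), (27, 33), (29, 33), (25, 34), (30, 34), (26, 35), (31, 35), (28, 36), (30, 36), (32, 36), (29, 37), (31, 37), (33, 37), (34, 38), (35, 38), (34, 39), (35, 40), (39, 41), (40, 42), (32, 43), (36, 43), (39, 43), (33, 44), (37, 44), (40, 44), (38, 45), (41, 45), (38, 46), (42, 46), (39, 47), (41, 47), (43, 47), (40, 48), (42, 48), (44, 48),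 (41, 49), (45, 49), (47, 49), (42, 50), (46, 50), (48, 50), (45, 51), (46, 51), (49, 51), (50, 51)]
def KK : List (Fin 15) := [0, 1, 1, 2, 2, 4, 4, 3, 3, 5, 5, 6, 6, 7, 9, 9, 8, 8, 10, 10, 11, 11, 12, 12, 13, 14, 14, 13, 12, 12, 11, 11, 10, 10, 8, 8, 9, 9, 7, 6, 6, 5, 5, 3, 3, 4, 4, 2, 2, 1, 1, 0]
def SX : List ℤ := [1, 1, -1, 1, -1, 1, -1, 1, -1, 1, -1, 1, -1, 1, 1, -1, 1, -1, 1, -1, 1, -1, 1, -1, 1, 1, -1, -1, 1, -1, 1, -1, 1, -1, 1, -1, 1, -1, 1, 1, -1, 1, -1, 1, -1, 1, -1, 1, -1, 1, -1, 1]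
def SY : List ℤ := [1, 1, 1, 1, 1, 1, 1, 1, 1, 1, 1, 1, 1, 1, 1, 1, 1, 1, 1, 1, 1, 1, 1, 1, 1, 1, 1, 1, -1, -1, -1, -1, -1, -1, -1, -1, -1, -1, -1, -1, -1, -1, -1, -1, -1, -1, -1, -1, -1, -1, -1, -1]
def IX : List ℤ := [0, 920, 1840, 2760, 121, 1041, 1961, 0, 998, 2194, 3191, 1628, 2625, 3621, 640]
def IY : List ℤ := [2980, 2589, 2197, 1805, 1988, 1596, 1204, 995, 934, 981, 903, 157, 78, 0, 0]
def base : List (Fin 15 × Fin 15) := [(0, 1), (1, 2), (0, 4), (1, 4), (2, 3), (1, 5), (2, 5), (4, 5), (2, 6), (3, 6), (5, 6), (4, 7), (3, 9), (6, 8), (7, 8), (3, 10), (9, 10), (9, 11), (8, 11), (9, 12), (10, 12), (11, 12), (10, 13), (12, 13), (8, 14), (11, 14)]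

def kk (i : Fin 52) : Fin 15 := KK.getD i.val 0
def sx (i : Fin 52) : ℤ := SX.getD i.val 1
def sy (i : Fin 52) : ℤ := SY.getD i.val 1
def ix (k : Fin 15) : ℤ := IX.getD k.val 0
def iy (k : Fin 15) : ℤ := IY.getD k.val 0
def jx (i : Fin 52) : ℤ := sx i * ix (kk i)
def jy (i : Fin 52) : ℤ := sy i * iy (kk i)

def XN : List ℕ := [4000, 4920, 3080, 5840, 2160, 4121, 3879, 6760, 1240, 5041, 2959, 5961, 2039, 4000, 6194, 1806, 4998, 3002, 7191, 809, 5628, 2372, 6625, 1375, 7621, 4640, 3360, 379, 6625, 1375, 5628, 2372, 7191, 809, 4998, 3002, 6194, 1806, 4000, 5961, 2039, 5041, 2959, 6760, 1240, 4121, 3879, 5840, 2160, 4920, 3080, 4000]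
def YN : List ℕ := [6980, 6589, 6589, 6197, 6197, 5988, 5988, 5805, 5805, 5596, 5596, 5204, 5204, 4995, 4981, 4981, 4934, 4934, 4903, 4903, 4157, 4157, 4078, 4078, 4000, 4000, 4000, 4000, 3922, 3922, 3843, 3843, 3097, 3097, 3066, 3066, 3019, 3019, 3005, 2796, 2796, 2404, 2404, 2195, 2195, 2012, 2012, 1803, 1803, 1411, 1411, 1020]
def xn (i : ℕ) : ℕ := XN.getD i 0
def yn (i : ℕ) : ℕ := YN.getD i 0
def EN : List (ℕ × ℕ × ℕ × ℕ × ℕ × ℕ) := [(0, 1, 4000, 6980, 4920, 6589), (0, 2, 4000, 6980, 3080, 6589), (1, 3, 4920, 6589, 5840, 6197), (2, 4, 3080, 6589, 2160, 6197), (0, 5, 4000, 6980, 4121, 5988), (1, 5, 4920, 6589, 4121, 5988), (0, 6, 4000, 6980, 3879, 5988), (2, 6, 3080, 6589, 3879, 5988), (3, 7, 5840, 6197, 6760, 5805), (4, 8, 2160, 6197, 1240, 5805), (1, 9, 4920, 6589, 5041, 5596), (3, 9, 5840, 6197, 5041, 5596), (5, 9, 4121, 5988, 5041, 5596), (2, 10,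 3080, 6589, 2959, 5596), (4, 10, 2160, 6197, 2959, 5596), (6, 10, 3879, 5988, 2959, 5596), (3, 11, 5840, 6197, 5961, 5204), (7, 11, 6760, 5805, 5961, 5204), (9, 11, 5041, 5596, 5961, 5204), (4, 12, 2160, 6197, 2039, 5204), (8, 12, 1240, 5805, 2039, 5204), (10, 12, 2959, 5596, 2039, 5204), (5, 13, 4121, 5988, 4000, 4995), (6, 13, 3879, 5988, 4000, 4995), (7, 14, 6760, 5805, 6194, 4981), (8, 15, 1240, 5805, 1806, 4981), (11, 16, 5961, 5204, 4998, 4934), (13, 16, 4000, 4995, 4998, 4934), (12, 17, 2039, 5204, 3002, 4934), (13, 17, 4000, 4995, 3002, 4934), (7, 18, 6760, 5805, 7191, 4903), (14, 18, 6194, 4981, 7191, 4903), (8, 19, 1240, 5805, 809, 4903), (15, 19, 1806, 4981, 809, 4903), (14, 20, 6194, 4981, 5628, 4157), (16, 20, 4998, 4934, 5628, 4157), (15, 21, 1806, 4981, 2372, 4157), (17, 21, 3002, 4934, 2372, 4157), (14, 22, 6194, 4981, 6625, 4078), (18, 22, 7191, 4903, 6625, 4078), (20, 22, 5628, 4157,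 6625, 4078), (15, 23, 1806, 4981, 1375, 4078), (19, 23, 809, 4903, 1375, 4078), (21, 23, 2372, 4157, 1375, 4078), (18, 24, 7191, 4903, 7621, 4000), (22, 24, 6625, 4078, 7621, 4000), (16, 25, 4998, 4934, 4640, 4000), (20, 25, 5628, 4157, 4640, 4000), (17, 26, 3002, 4934, 3360, 4000), (21, 26, 2372, 4157, 3360, 4000), (19, 27, 809, 4903, 379, 4000), (23, 27, 1375, 4078, 379, 4000), (24, 28, 7621, 4000, 6625, 3922), (27, 29, 379, 4000, 1375, 3922), (25, 30, 4640, 4000, 5628, 3843), (28, 30, 6625, 3922, 5628, 3843), (26, 31, 3360, 4000, 2372, 3843), (29, 31, 1375, 3922, 2372, 3843), (24, 32, 7621, 4000, 7191, 3097), (28, 32, 6625, 3922, 7191, 3097), (27, 33, 379, 4000, 809, 3097), (29, 33, 1375, 3922, 809, 3097), (25, 34, 4640, 4000, 4998, 3066), (30, 34, 5628, 3843, 4998, 3066), (26, 35, 3360, 4000, 3002, 3066), (31, 35, 2372, 3843, 3002, 3066), (28, 36, 6625, 3922, 6194, 3019), (30, 36, 5628, 3843, 6194, 3019), (32, 36,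 7191, 3097, 6194, 3019), (29, 37, 1375, 3922, 1806, 3019), (31, 37, 2372, 3843, 1806, 3019), (33, 37, 809, 3097, 1806, 3019), (34, 38, 4998, 3066, 4000, 3005), (35, 38, 3002, 3066, 4000, 3005), (34, 39, 4998, 3066, 5961, 2796), (35, 40, 3002, 3066, 2039, 2796), (39, 41, 5961, 2796, 5041, 2404), (40, 42, 2039, 2796, 2959, 2404), (32, 43, 7191, 3097, 6760, 2195), (36, 43, 6194, 3019, 6760, 2195), (39, 43, 5961, 2796, 6760, 2195), (33, 44, 809, 3097, 1240, 2195), (37, 44, 1806, 3019, 1240, 2195), (40, 44, 2039, 2796, 1240, 2195), (38, 45, 4000, 3005, 4121, 2012), (41, 45, 5041, 2404, 4121, 2012), (38, 46, 4000, 3005, 3879, 2012), (42, 46, 2959, 2404, 3879, 2012), (39, 47, 5961, 2796, 5840, 1803), (41, 47, 5041, 2404, 5840, 1803), (43, 47, 6760, 2195, 5840, 1803), (40, 48, 2039, 2796, 2160, 1803), (42, 48, 2959, 2404, 2160, 1803), (44, 48, 1240, 2195, 2160, 1803), (41, 49, 5041, 2404, 4920, 1411), (45, 49, 4121, 2012,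 4920, 1411), (47, 49, 5840, 1803, 4920, 1411), (42, 50, 2959, 2404, 3080, 1411), (46, 50, 3879, 2012, 3080, 1411), (48, 50, 2160, 1803, 3080, 1411), (45, 51, 4121, 2012, 4000, 1020), (46, 51, 3879, 2012, 4000, 1020), (49, 51, 4920, 1411, 4000, 1020), (50, 51, 3080, 1411, 4000, 1020)]
def enc (e : Fin 52 × Fin 52) : ℕ × ℕ × ℕ × ℕ × ℕ × ℕ :=
  (e.1.val, e.2.val, xn e.1.val, yn e.1.val, xn e.2.val, yn e.2.val)

def sep4 (m p q r s : ℕ) : Bool :=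
  Nat.blt (p + m) r && Nat.blt (p + m) s && Nat.blt (q + m) r && Nat.blt (q + m) s

def chk : ℕ × ℕ × ℕ × ℕ × ℕ × ℕ → ℕ × ℕ × ℕ × ℕ × ℕ × ℕ → Bool
  | (i, j, a, b, c, d), (i', j', a', b', c', d') =>
    sep4 40 a c a' c' || sep4 40 a' c' a c || sep4 40 b d b' d' || sep4 40 b' d' b d ||
    Nat.beq i i' || Nat.beq i j' || Nat.beq j i' || Nat.beq j j' ||
    sep4 120 (a + 2 * b) (c + 2 * d) (a' + 2 * b') (c' + 2 * d') ||
    sep4 120 (a' + 2 * b') (c' + 2 * d') (a + 2 * b) (c + 2 * d) ||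
    sep4 120 (a + 2 * (8000 - b)) (c + 2 * (8000 - d)) (a' + 2 * (8000 - b')) (c' + 2 * (8000 - d')) ||
    sep4 120 (a' + 2 * (8000 - b')) (c' + 2 * (8000 - d')) (a + 2 * (8000 - b)) (c + 2 * (8000 - d))

theorem nodup : EL.Nodup := by decide +kernel
theorem chk_pairs : (EN.all fun e => EN.all fun f => chk e f) = true := by
  decide +kernel
theorem chk_enc : EL.map enc = EN := by decide +kernel
theorem chk_xn : ∀ i : Fin 52, (xn i.val : ℤ) = jx i + 4000 := by decide +kernel
theorem chk_yn : ∀ i : Fin 52, (yn i.val : ℤ) = jy i + 4000 := by decide +kernel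
theorem chk_y8 : ∀ i : Fin 52, yn i.val ≤ 8000 := by decide +kernel
theorem chk_inj : ((List.range 52).all fun i => (List.range 52).all fun j =>
    Nat.beq i j || Nat.blt (xn i + 40) (xn j) || Nat.blt (xn j + 40) (xn i) ||
    Nat.blt (yn i + 40) (yn j) || Nat.blt (yn j + 40) (yn i)) = true := by
  decide +kernel
theorem chk_deg : ∀ v : Fin 52, (EL.filter (fun e => e.1 = v ∨ e.2 = v)).length = 4 := by
  decide +kernel
theorem chk_lt0 : (EL.all fun e => decide (e.1 < e.2)) = true := by decide +kernel
theorem chk_lt : ∀ e ∈ EL, e.1 < e.2 := fun e he =>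
  of_decide_eq_true (List.all_eq_true.1 chk_lt0 e he)
theorem chk_sgn : ∀ i, (sx i = 1 ∨ sx i = -1) ∧ (sy i = 1 ∨ sy i = -1) := by decide +kernel
theorem chk_base0 : (EL.all fun e => decide (
    ((kk e.1, kk e.2) ∈ base ∨ (kk e.2, kk e.1) ∈ base) ∧
    (sx e.1 = sx e.2 ∨ kk e.1 = 0 ∨ kk e.1 = 7 ∨ kk e.2 = 0 ∨ kk e.2 = 7) ∧
    (sy e.1 = sy e.2 ∨ kk e.1 = 13 ∨ kk e.1 = 14 ∨ kk e.2 = 13 ∨ kk e.2 = 14))) = true := by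
  decide +kernel
theorem chk_base : ∀ e ∈ EL, ((kk e.1, kk e.2) ∈ base ∨ (kk e.2, kk e.1) ∈ base) ∧
    (sx e.1 = sx e.2 ∨ kk e.1 = 0 ∨ kk e.1 = 7 ∨ kk e.2 = 0 ∨ kk e.2 = 7) ∧
    (sy e.1 = sy e.2 ∨ kk e.1 = 13 ∨ kk e.1 = 14 ∨ kk e.2 = 13 ∨ kk e.2 = 14) :=
  fun e he => of_decide_eq_true (List.all_eq_true.1 chk_base0 e he)

set_option maxHeartbeats 4000000 in
theorem quarter : ∃ X Y : Fin 15 → ℝ, X 0 = 0 ∧ X 7 = 0 ∧ Y 13 = 0 ∧ Y 14 = 0 ∧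
    (∀ k, |1000 * X k - (ix k : ℝ)| ≤ 20) ∧ (∀ k, |1000 * Y k - (iy k : ℝ)| ≤ 20) ∧
    ∀ e ∈ base, (X e.1 - X e.2) ^ 2 + (Y e.1 - Y e.2) ^ 2 = 1 := by
  obtain ⟨r, c, s, u, v, x, y, hr, hcs, hxy, hg, hf, h1, h2, br, bc, bs, bu, bv, bx, by'⟩ := core
  have prc := mul_bd br.1 br.2 bc.1 bc.2 (by norm_num) (by norm_num) (le_refl _) (le_refl _)
  have prs := mul_bd br.1 br.2 bs.1 bs.2 (by norm_num) (by norm_num) (le_refl _) (le_refl _)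
  have prx := mul_bd br.1 br.2 bx.1 bx.2 (by norm_num) (by norm_num) (le_refl _) (le_refl _)
  have pry := mul_bd br.1 br.2 by'.1 by'.2 (by norm_num) (by norm_num) (le_refl _) (le_refl _)
  have prv := mul_bd br.1 br.2 bv.1 bv.2 (by norm_num) (by norm_num) (le_refl _) (le_refl _)
  refine ⟨![0, c, 2 * c, 3 * c, (c - r * s) / 2, (c - r * s) / 2 + c, (c - r * s) / 2 + 2 * c, 0,
      3 * c - u, 3 * c - x, 3 * c - (x - r * y) / 2, 3 * c - 2 * x, 3 * c - x - (x - r * y) / 2,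
      3 * c - (x - r * y), 3 * c - u + (u - 2 * x + (r * v - 2 * (r * y))) / 2],
    ![3 * s + y + r * x, 2 * s + y + r * x, s + y + r * x, y + r * x,
      3 * s + y + r * x - (s + r * c) / 2, 2 * s + y + r * x - (s + r * c) / 2,
      s + y + r * x - (s + r * c) / 2, 3 * s + y + r * x - (s + r * c),
      y + r * x - v, r * x, (y + r * x) / 2, r * x - y, (r * x - y) / 2, 0, 0],
    rfl, rfl, rfl, rfl, ?_, ?_, ?_⟩
  · intro k
    norm_num at br bc bs bu bv bx by' prc prs prx pry prv
    fin_cases k <;> norm_num [ix, IX] <;> rw [abs_le] <;> constructor <;> linarith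
  · intro k
    norm_num at br bc bs bu bv bx by' prc prs prx pry prv
    fin_cases k <;> norm_num [iy, IY] <;> rw [abs_le] <;> constructor <;> linarith
  · have hY : y + r * x - v = -(v - 2 * y - r * (u - 2 * x)) / 2 := by linarith
    have hY2 : r * x - y = (v - 2 * y + r * (u - 2 * x)) / 2 := by linarith
    simp only [base, List.forall_mem_cons, List.not_mem_nil, false_imp_iff, implies_true, and_true]
    refine ⟨?_, ?_, ?_, ?_, ?_, ?_, ?_, ?_, ?_, ?_, ?_, ?_, ?_, ?_, ?_, ?_, ?_, ?_, ?_, ?_, ?_, ?_,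
      ?_, ?_, ?_, ?_⟩ <;> simp <;>
    first
    | linear_combination hcs
    | linear_combination (c ^ 2 + s ^ 2) / 4 * hr + hcs
    | linear_combination hxy
    | linear_combination (x ^ 2 + y ^ 2) / 4 * hr + hxy
    | linear_combination hg
    | linear_combination h1
    | linear_combination h2
    | linear_combination ((u - 2 * x) ^ 2 + (v - 2 * y) ^ 2) / 4 * hr + hg +
        (y + r * x - v + -(v - 2 * y - r * (u - 2 * x)) / 2) * hY
    | linear_combination ((u - 2 * x) ^ 2 + (v - 2 * y) ^ 2) / 4 * hr + hg +
        (r * x - y + (v - 2 * y + r * (u - 2 * x)) / 2) * hY2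

theorem sgn_sq {a b : ℤ} {x y : ℝ} (ha : a = 1 ∨ a = -1) (hb : b = 1 ∨ b = -1)
    (h : a = b ∨ x = 0 ∨ y = 0) : ((a : ℝ) * x - b * y) ^ 2 = (x - y) ^ 2 := by
  rcases h with h | h | h
  · subst h
    rcases ha with h | h <;> subst h <;> push_cast <;> ring
  · subst h
    rcases ha with h | h <;> rcases hb with h' | h' <;> subst h <;> subst h' <;> push_cast <;> ring
  · subst h
    rcases ha with h | h <;> rcases hb with h' | h' <;> subst h <;> subst h' <;> push_cast <;> ring

theorem sgn_abs {a k : ℤ} {x : ℝ} (ha : a = 1 ∨ a = -1) (h : |1000 * x - (k : ℝ)| ≤ 20) :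
    |1000 * ((a : ℝ) * x) - ((a * k : ℤ) : ℝ)| ≤ 20 := by
  rcases ha with h' | h' <;> subst h'
  · simpa using h
  · rw [← abs_neg]; push_cast; convert h using 2; ring

theorem star {A B C x : EuclideanSpace ℝ (Fin 2)} (hB : dist A B = 1) (hC : dist A C = 1)
    (hBC : B ≠ C) (h1 : x ∈ segment ℝ A B) (h2 : x ∈ segment ℝ A C) : x = A := by
  rw [segment_eq_image_lineMap] at h1 h2
  obtain ⟨s, hs, rfl⟩ := h1
  obtain ⟨t, ht, h⟩ := h2
  have e1 : dist (AffineMap.lineMap A B s) A = s := by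
    rw [dist_lineMap_left, hB, Real.norm_of_nonneg hs.1, mul_one]
  have e2 : dist (AffineMap.lineMap A C t) A = t := by
    rw [dist_lineMap_left, hC, Real.norm_of_nonneg ht.1, mul_one]
  rw [h, e1] at e2
  subst e2
  by_cases h0 : s = 0
  · subst h0; simp
  · exfalso
    apply hBC
    rw [AffineMap.lineMap_apply, AffineMap.lineMap_apply] at h
    have h' := vadd_right_cancel _ h
    have h'' := smul_right_injective _ h0 h'
    exact (vsub_left_cancel h'').symm

theorem sep_seg (a b : ℝ) {p q r s x : EuclideanSpace ℝ (Fin 2)}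
    (h1 : a * p 0 + b * p 1 < a * r 0 + b * r 1) (h2 : a * p 0 + b * p 1 < a * s 0 + b * s 1)
    (h3 : a * q 0 + b * q 1 < a * r 0 + b * r 1) (h4 : a * q 0 + b * q 1 < a * s 0 + b * s 1)
    (hx : x ∈ segment ℝ p q) (hy : x ∈ segment ℝ r s) : False := by
  obtain ⟨α, β, hα, hβ, hs, rfl⟩ := hx
  obtain ⟨γ, δ, hγ, hδ, ht, h⟩ := hy
  have e0 : γ * r 0 + δ * s 0 = α * p 0 + β * q 0 := by
    simpa using congrArg (fun z : EuclideanSpace ℝ (Fin 2) => z 0) h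
  have e1 : γ * r 1 + δ * s 1 = α * p 1 + β * q 1 := by
    simpa using congrArg (fun z : EuclideanSpace ℝ (Fin 2) => z 1) h
  have key : γ * (a * r 0 + b * r 1) + δ * (a * s 0 + b * s 1)
      = α * (a * p 0 + b * p 1) + β * (a * q 0 + b * q 1) := by
    linear_combination a * e0 + b * e1
  generalize a * p 0 + b * p 1 = P at *
  generalize a * q 0 + b * q 1 = Q at *
  generalize a * r 0 + b * r 1 = R at *
  generalize a * s 0 + b * s 1 = S at *
  have m1 : max P Q < min R S := max_lt (lt_min h1 h2) (lt_min h3 h4)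
  have m2 : α * P + β * Q ≤ max P Q := by
    calc α * P + β * Q ≤ α * max P Q + β * max P Q := by gcongr <;> simp
      _ = max P Q := by rw [← add_mul, hs, one_mul]
  have m3 : min R S ≤ γ * R + δ * S := by
    calc min R S = γ * min R S + δ * min R S := by rw [← add_mul, ht, one_mul]
      _ ≤ γ * R + δ * S := by gcongr <;> simp
  linarith

end Harb

theorem harborth_graph_exists :
    ∃ (P : Fin 52 → EuclideanSpace ℝ (Fin 2)) (E : Finset (Fin 52 × Fin 52)),
      Function.Injective P ∧
      (∀ e ∈ E, e.1 < e.2) ∧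
      E.card = 104 ∧
      (∀ v : Fin 52, (E.filter (fun e => e.1 = v ∨ e.2 = v)).card = 4) ∧
      (∀ e ∈ E, ∀ f ∈ E, e ≠ f →
        ∀ x ∈ segment ℝ (P e.1) (P e.2) ∩ segment ℝ (P f.1) (P f.2),
          (x = P e.1 ∨ x = P e.2) ∧ (x = P f.1 ∨ x = P f.2)) ∧
      (∀ e ∈ E, dist (P e.1) (P e.2) = 1) := by
  obtain ⟨X, Y, hX0, hX7, hY13, hY14, hax, hay, hbase⟩ := Harb.quarter
  let P : Fin 52 → EuclideanSpace ℝ (Fin 2) := fun i =>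
    !₂[(Harb.sx i : ℝ) * X (Harb.kk i), (Harb.sy i : ℝ) * Y (Harb.kk i)]
  have P0 : ∀ i, P i 0 = (Harb.sx i : ℝ) * X (Harb.kk i) := fun i => rfl
  have P1 : ∀ i, P i 1 = (Harb.sy i : ℝ) * Y (Harb.kk i) := fun i => rfl
  have bx : ∀ i, |1000 * P i 0 - ((Harb.xn i.val : ℝ) - 4000)| ≤ 20 := by
    intro i
    have h := Harb.sgn_abs (Harb.chk_sgn i).1 (hax (Harb.kk i))
    have h2 : ((Harb.xn i.val : ℤ) : ℝ) = ((Harb.jx i + 4000 : ℤ) : ℝ) := by rw [Harb.chk_xn i]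
    have h3 : (Harb.xn i.val : ℝ) - 4000 = ((Harb.jx i : ℤ) : ℝ) := by push_cast at h2; linarith
    rw [h3]; exact h
  have bY : ∀ i, |1000 * P i 1 - ((Harb.yn i.val : ℝ) - 4000)| ≤ 20 := by
    intro i
    have h := Harb.sgn_abs (Harb.chk_sgn i).2 (hay (Harb.kk i))
    have h2 : ((Harb.yn i.val : ℤ) : ℝ) = ((Harb.jy i + 4000 : ℤ) : ℝ) := by rw [Harb.chk_yn i]
    have h3 : (Harb.yn i.val : ℝ) - 4000 = ((Harb.jy i : ℤ) : ℝ) := by push_cast at h2; linarith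
    rw [h3]; exact h
  clear_value P
  have inj : Function.Injective P := by
    intro i j hij
    by_contra hne
    have hc := Harb.chk_inj
    simp only [List.all_eq_true, List.mem_range] at hc
    have h := hc i.val i.isLt j.val j.isLt
    simp only [Bool.or_eq_true, Nat.blt_eq] at h
    have x1 := abs_le.1 (bx i)
    have x2 := abs_le.1 (bx j)
    have y1 := abs_le.1 (bY i)
    have y2 := abs_le.1 (bY j)
    rw [hij] at x1 y1
    rcases h with (((h | h) | h) | h) | h
    · exact hne (Fin.ext (Nat.eq_of_beq_eq_true h))
    all_goals
      have h' := (Nat.cast_lt (α := ℝ)).2 h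
      push_cast at h'
      linarith [x1.1, x1.2, x2.1, x2.2, y1.1, y1.2, y2.1, y2.2]
  have hdist : ∀ e ∈ Harb.EL, dist (P e.1) (P e.2) = 1 := by
    intro e he
    obtain ⟨h1, h2, h3⟩ := Harb.chk_base e he
    rw [EuclideanSpace.dist_eq, Fin.sum_univ_two, Real.dist_eq, Real.dist_eq, sq_abs, sq_abs,
      P0, P0, P1, P1]
    rw [Harb.sgn_sq (Harb.chk_sgn _).1 (Harb.chk_sgn _).1 (x := X (Harb.kk e.1)),
      Harb.sgn_sq (Harb.chk_sgn _).2 (Harb.chk_sgn _).2 (x := Y (Harb.kk e.1))]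
    · rw [Real.sqrt_eq_one]
      rcases h1 with h | h
      · exact hbase _ h
      · rw [← hbase _ h]; ring
    · rcases h3 with h | h | h | h | h <;> simp [h, hY13, hY14]
    · rcases h2 with h | h | h | h | h <;> simp [h, hX0, hX7]
  refine ⟨P, ⟨(Harb.EL : Multiset (Fin 52 × Fin 52)), Harb.nodup⟩, inj, Harb.chk_lt, rfl, ?_, ?_, hdist⟩
  · intro v
    rw [← Harb.chk_deg v]
    simp only [Finset.filter, Finset.card, Multiset.filter_coe, Multiset.coe_card]
  · intro e he f hf hef x hx
    replace he : e ∈ Harb.EL := he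
    replace hf : f ∈ Harb.EL := hf
    obtain ⟨hx1, hx2⟩ := hx
    have le := Harb.chk_lt e he
    have lf := Harb.chk_lt f hf
    have de := hdist e he
    have df := hdist f hf
    have hc := Harb.chk_pairs
    simp only [List.all_eq_true] at hc
    have h := hc (Harb.enc e) (Harb.chk_enc ▸ List.mem_map_of_mem he)
      (Harb.enc f) (Harb.chk_enc ▸ List.mem_map_of_mem hf)
    obtain ⟨i, j⟩ := e
    obtain ⟨k, l⟩ := f
    simp only at *
    simp only [Harb.enc, Harb.chk, Harb.sep4, Bool.or_eq_true, Bool.and_eq_true,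
      Nat.blt_eq] at h
    have xi := abs_le.1 (bx i)
    have xj := abs_le.1 (bx j)
    have xk := abs_le.1 (bx k)
    have xl := abs_le.1 (bx l)
    have yi := abs_le.1 (bY i)
    have yj := abs_le.1 (bY j)
    have yk := abs_le.1 (bY k)
    have yl := abs_le.1 (bY l)
    have zi := Harb.chk_y8 i
    have zj := Harb.chk_y8 j
    have zk := Harb.chk_y8 k
    have zl := Harb.chk_y8 l
    rcases h with ((((((((((h | h) | h) | h) | h) | h) | h) | h) | h) | h) | h) | h
    · exfalso
      obtain ⟨⟨⟨g1, g2⟩, g3⟩, g4⟩ := h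
      rify at g1 g2 g3 g4
      refine Harb.sep_seg 1 0 ?_ ?_ ?_ ?_ hx1 hx2 <;> linarith
    · exfalso
      obtain ⟨⟨⟨g1, g2⟩, g3⟩, g4⟩ := h
      rify at g1 g2 g3 g4
      refine Harb.sep_seg 1 0 ?_ ?_ ?_ ?_ hx2 hx1 <;> linarith
    · exfalso
      obtain ⟨⟨⟨g1, g2⟩, g3⟩, g4⟩ := h
      rify at g1 g2 g3 g4
      refine Harb.sep_seg 0 1 ?_ ?_ ?_ ?_ hx1 hx2 <;> linarith
    · exfalso
      obtain ⟨⟨⟨g1, g2⟩, g3⟩, g4⟩ := h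
      rify at g1 g2 g3 g4
      refine Harb.sep_seg 0 1 ?_ ?_ ?_ ?_ hx2 hx1 <;> linarith
    · have h := Fin.ext (Nat.eq_of_beq_eq_true h)
      subst h
      have hjl : P j ≠ P l := fun hh => hef (by rw [inj hh])
      have := Harb.star de df hjl hx1 hx2
      exact ⟨Or.inl this, Or.inl this⟩
    · have h := Fin.ext (Nat.eq_of_beq_eq_true h)
      subst h
      have hjl : P j ≠ P k := fun hh => absurd (inj hh) (lf.trans le).ne'
      rw [segment_symm] at hx2
      rw [dist_comm] at df
      have := Harb.star de df hjl hx1 hx2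
      exact ⟨Or.inl this, Or.inr this⟩
    · have h := Fin.ext (Nat.eq_of_beq_eq_true h)
      subst h
      have hjl : P i ≠ P l := fun hh => absurd (inj hh) (le.trans lf).ne
      rw [segment_symm] at hx1
      rw [dist_comm] at de
      have := Harb.star de df hjl hx1 hx2
      exact ⟨Or.inr this, Or.inl this⟩
    · have h := Fin.ext (Nat.eq_of_beq_eq_true h)
      subst h
      have hjl : P i ≠ P k := fun hh => hef (by rw [inj hh])
      rw [segment_symm] at hx1 hx2
      rw [dist_comm] at de df
      have := Harb.star de df hjl hx1 hx2
      exact ⟨Or.inr this, Or.inr this⟩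
    · exfalso
      obtain ⟨⟨⟨g1, g2⟩, g3⟩, g4⟩ := h
      rify at g1 g2 g3 g4
      refine Harb.sep_seg 1 2 ?_ ?_ ?_ ?_ hx1 hx2 <;> linarith
    · exfalso
      obtain ⟨⟨⟨g1, g2⟩, g3⟩, g4⟩ := h
      rify at g1 g2 g3 g4
      refine Harb.sep_seg 1 2 ?_ ?_ ?_ ?_ hx2 hx1 <;> linarith
    · exfalso
      obtain ⟨⟨⟨g1, g2⟩, g3⟩, g4⟩ := h
      rify [zi, zj, zk, zl] at g1 g2 g3 g4
      refine Harb.sep_seg 1 (-2) ?_ ?_ ?_ ?_ hx1 hx2 <;> linarith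
    · exfalso
      obtain ⟨⟨⟨g1, g2⟩, g3⟩, g4⟩ := h
      rify [zi, zj, zk, zl] at g1 g2 g3 g4
      refine Harb.sep_seg 1 (-2) ?_ ?_ ?_ ?_ hx2 hx1 <;> linarith
end

section
/- For each n ∈ {52, 54, 57, 60, 64} there exists a 4-regular matchstick graph with exactly n vertices; that is, there exist n distinct points in ℝ² and a set E of 2n unordered pairs of these points such that each pair consists of two points at distance exactly 1, every point is an endpoint of exactly 4 pairs, and the closed segments of any two distinct pairs intersect at most in a common endpoint. -/
open scoped Classical


namespace Matchstick

def dotZ : List ℤ → List ℤ → ℤ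
  | a :: as, b :: bs => a * b + dotZ as bs
  | _, _ => 0

noncomputable def dotR : List ℤ → List ℝ → ℝ
  | a :: as, b :: bs => (a : ℝ) * b + dotR as bs
  | _, _ => 0

def iabs (x : ℤ) : ℤ := (x.natAbs : ℤ)

theorem iabs_eq (x : ℤ) : iabs x = |x| := Int.natCast_natAbs x

def nrm1 : List ℤ → ℤ
  | [] => 0
  | a :: as => iabs a + nrm1 as

def addL : List ℤ → List ℤ → List ℤ
  | a :: as, b :: bs => (a + b) :: addL as bs
  | [], bs => bs
  | as, [] => as

def negL (l : List ℤ) : List ℤ := l.map (fun a => -a)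

theorem dotR_nil_left (z : List ℝ) : dotR [] z = 0 := by cases z <;> rfl
theorem dotR_nil_right (f : List ℤ) : dotR f [] = 0 := by cases f <;> rfl
theorem dotZ_nil_left (z : List ℤ) : dotZ [] z = 0 := by cases z <;> rfl
theorem dotZ_nil_right (f : List ℤ) : dotZ f [] = 0 := by cases f <;> rfl

theorem dotR_addL (f g : List ℤ) (z : List ℝ) : dotR (addL f g) z = dotR f z + dotR g z := by
  induction z generalizing f g with
  | nil => simp [dotR_nil_right]
  | cons x xs ih =>
    cases f with
    | nil => cases g <;> simp [addL, dotR_nil_left]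
    | cons a as =>
      cases g with
      | nil => simp [addL, dotR_nil_left]
      | cons b bs => simp only [addL, dotR, ih]; push_cast; ring

theorem dotR_negL (f : List ℤ) (z : List ℝ) : dotR (negL f) z = - dotR f z := by
  induction z generalizing f with
  | nil => simp [dotR_nil_right]
  | cons x xs ih =>
    cases f with
    | nil => simp [negL, dotR_nil_left]
    | cons a as =>
      have := ih as
      simp only [negL] at this
      simp only [negL, List.map, dotR, this]; push_cast; ring

theorem nrm1_nonneg (f : List ℤ) : 0 ≤ nrm1 f := by
  induction f with
  | nil => simp [nrm1]
  | cons a as ih => simp only [nrm1, iabs_eq]; positivity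

/-- approximations of the parameters give approximations of linear forms -/
theorem dot_approx (z : List ℝ) (z0 : List ℤ)
    (hz : List.Forall₂ (fun (x : ℝ) (q : ℤ) => |10 ^ 12 * x - q| ≤ 10 ^ 6) z z0) (f : List ℤ) :
    |10 ^ 12 * dotR f z - (dotZ f z0 : ℝ)| ≤ (10 : ℝ) ^ 6 * (nrm1 f : ℝ) := by
  induction hz generalizing f with
  | nil =>
    rw [dotR_nil_right, dotZ_nil_right]
    have : (0:ℝ) ≤ nrm1 f := by exact_mod_cast nrm1_nonneg f
    simpa using this
  | @cons x q xs qs h _ ih =>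
    cases f with
    | nil => simp [dotR, dotZ, nrm1]
    | cons a as =>
      simp only [dotR, dotZ, nrm1, iabs_eq]
      push_cast
      have e : 10 ^ 12 * ((a:ℝ) * x + dotR as xs) - ((a:ℝ) * q + (dotZ as qs : ℝ))
        = a * (10 ^ 12 * x - q) + (10 ^ 12 * dotR as xs - (dotZ as qs : ℝ)) := by ring
      rw [e]
      refine le_trans (abs_add_le _ _) ?_
      rw [abs_mul]
      have := ih as
      have h2 := mul_le_mul_of_nonneg_left h (abs_nonneg (a:ℝ))
      linarith

/-- strict separation of the integer points `a, b` from `c, d` in the direction `(p, q)` -/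
def sepDir (p q : ℤ) (a b c d : ℤ × ℤ) : Bool :=
  let m := 4 * (iabs p + iabs q)
  decide (p * c.1 + q * c.2 + m < p * a.1 + q * a.2) &&
  decide (p * d.1 + q * d.2 + m < p * a.1 + q * a.2) &&
  decide (p * c.1 + q * c.2 + m < p * b.1 + q * b.2) &&
  decide (p * d.1 + q * d.2 + m < p * b.1 + q * b.2)

def sepDirs (p q : ℤ) (a b c d : ℤ × ℤ) : Bool :=
  sepDir p q a b c d || sepDir (-p) (-q) a b c d

def sep (a b c d : ℤ × ℤ) : Bool :=
  sepDirs (a.2 - b.2) (b.1 - a.1) a b c d || sepDirs (c.2 - d.2) (d.1 - c.1) a b c d ||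
  sepDirs (b.1 - a.1) (b.2 - a.2) a b c d

abbrev Pt := EuclideanSpace ℝ (Fin 2)

def near (x : Pt) (t : ℤ × ℤ) : Prop := |1000 * x 0 - t.1| ≤ 2 ∧ |1000 * x 1 - t.2| ≤ 2

theorem lin_lt (p q : ℤ) (x y : Pt) (s t : ℤ × ℤ) (hx : near x s) (hy : near y t)
    (h : p * t.1 + q * t.2 + 4 * (|p| + |q|) < p * s.1 + q * s.2) :
    (p : ℝ) * y 0 + q * y 1 < p * x 0 + q * x 1 := by
  have h' : (p:ℝ) * t.1 + q * t.2 + 4 * (|(p:ℝ)| + |(q:ℝ)|) < p * s.1 + q * s.2 := by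
    exact_mod_cast h
  have key : ∀ (c u v : ℝ), |u| ≤ 2 → |v| ≤ 2 → c * (v - u) ≤ |c| * 4 := by
    intro c u v hu hv
    have h1 : |v - u| ≤ 4 := le_trans (abs_sub _ _) (by linarith)
    calc c * (v - u) ≤ |c * (v - u)| := le_abs_self _
      _ = |c| * |v - u| := abs_mul _ _
      _ ≤ |c| * 4 := mul_le_mul_of_nonneg_left h1 (abs_nonneg _)
  have k1 := key p _ _ hx.1 hy.1
  have k2 := key q _ _ hx.2 hy.2
  nlinarith

theorem seg_lin_gt (p q M : ℝ) (x y w : Pt) (hx : M < p * x 0 + q * x 1)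
    (hy : M < p * y 0 + q * y 1) (hw : w ∈ segment ℝ x y) : M < p * w 0 + q * w 1 := by
  obtain ⟨s, t, hs, ht, hst, rfl⟩ := hw
  simp only [PiLp.add_apply, PiLp.smul_apply, smul_eq_mul]
  rcases hs.eq_or_lt with h | h
  · subst h
    have : t = 1 := by linarith
    subst this
    linarith
  · have h1 := mul_lt_mul_of_pos_left hx h
    have h2 := mul_le_mul_of_nonneg_left hy.le ht
    have h3 : M = s * M + t * M := by rw [← add_mul, hst, one_mul]
    linarith

theorem sepDir_sound (p q : ℤ) (A B C D : Pt) (a b c d : ℤ × ℤ) (hA : near A a) (hB : near B b)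
    (hC : near C c) (hD : near D d) (h : sepDir p q a b c d = true) (x : Pt)
    (h1 : x ∈ segment ℝ A B) (h2 : x ∈ segment ℝ C D) : False := by
  simp only [sepDir, iabs_eq, Bool.and_eq_true, decide_eq_true_eq] at h
  obtain ⟨⟨⟨hac, had⟩, hbc⟩, hbd⟩ := h
  have e1 := lin_lt p q _ _ _ _ hA hC hac
  have e2 := lin_lt p q _ _ _ _ hA hD had
  have e3 := lin_lt p q _ _ _ _ hB hC hbc
  have e4 := lin_lt p q _ _ _ _ hB hD hbd
  have f1 := seg_lin_gt p q _ A B x e1 e3 h1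
  have f2 := seg_lin_gt p q _ A B x e2 e4 h1
  have f3 := seg_lin_gt (-p) (-q) (-(p * x 0 + q * x 1)) C D x (by linarith) (by linarith) h2
  linarith

theorem sep_sound (A B C D : Pt) (a b c d : ℤ × ℤ) (hA : near A a) (hB : near B b)
    (hC : near C c) (hD : near D d) (h : sep a b c d = true) (x : Pt)
    (h1 : x ∈ segment ℝ A B) (h2 : x ∈ segment ℝ C D) : False := by
  simp only [sep, sepDirs, Bool.or_eq_true] at h
  rcases h with ((h | h) | (h | h)) | (h | h) <;>
    exact sepDir_sound _ _ A B C D a b c d hA hB hC hD h x h1 h2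

/-- two unit segments with a common endpoint and different other endpoints -/
theorem share_sound (C A B : Pt) (hA : dist C A = 1) (hB : dist C B = 1) (hAB : A ≠ B) (x : Pt)
    (h1 : x ∈ segment ℝ C A) (h2 : x ∈ segment ℝ C B) : x = C := by
  rw [segment_eq_image'] at h1 h2
  obtain ⟨s, ⟨hs, -⟩, rfl⟩ := h1
  obtain ⟨t, ⟨ht, -⟩, e⟩ := h2
  simp only at e ⊢
  have e' : t • (B - C) = s • (A - C) := add_left_cancel e
  have hn := congrArg norm e'
  rw [norm_smul, norm_smul, ← dist_eq_norm, ← dist_eq_norm, dist_comm B, dist_comm A, hA, hB,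
    Real.norm_of_nonneg hs, Real.norm_of_nonneg ht, mul_one, mul_one] at hn
  subst hn
  by_cases h0 : t = 0
  · simp [h0]
  · exact absurd (sub_left_inj.1 (smul_right_injective _ h0 e')).symm hAB

def farB (s t : ℤ × ℤ) : Bool :=
  decide (4 < iabs (s.1 - t.1)) || decide (4 < iabs (s.2 - t.2))

theorem far_sound (A B : Pt) (a b : ℤ × ℤ) (hA : near A a) (hB : near B b)
    (h : farB a b = true) : A ≠ B := by
  rintro rfl
  simp only [farB, iabs_eq, Bool.or_eq_true, decide_eq_true_eq] at h
  have key : ∀ (u : ℝ) (s t : ℤ), |u - s| ≤ 2 → |u - t| ≤ 2 → ¬ 4 < |s - t| := by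
    intro u s t h1 h2 h3
    have h3' : (4:ℝ) < |(s:ℝ) - t| := by exact_mod_cast h3
    have : (s:ℝ) - t = (u - t) - (u - s) := by ring
    rw [this] at h3'
    have := abs_sub (u - (t:ℝ)) (u - s)
    linarith
  rcases h with h | h
  · exact key _ _ _ hA.1 hB.1 h
  · exact key _ _ _ hA.2 hB.2 h

def allN (N : ℕ) (p : ℕ → Bool) : Bool := Nat.rec true (fun k s => p k && s) N

theorem allN_sound (N : ℕ) (p : ℕ → Bool) (h : allN N p = true) (i : ℕ) (hi : i < N) :
    p i = true := by
  induction N with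
  | zero => exact absurd hi (Nat.not_lt_zero i)
  | succ N ih =>
    have h' : (p N && allN N p) = true := h
    rw [Bool.and_eq_true] at h'
    rcases Nat.lt_succ_iff_lt_or_eq.1 hi with h1 | h1
    · exact ih h'.2 h1
    · rw [h1]; exact h'.1

def pw {α : Type} (r : α → α → Bool) : List α → Bool
  | [] => true
  | a :: l => l.all (r a) && pw r l

theorem pw_sound {α : Type} (r : α → α → Bool) (l : List α) (h : pw r l = true) :
    l.Pairwise (fun a b => r a b = true) := by
  induction l with
  | nil => exact List.Pairwise.nil
  | cons a l ih =>
    simp only [pw, Bool.and_eq_true, List.all_eq_true] at h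
    exact List.Pairwise.cons h.1 (ih h.2)

abbrev Form := List ℤ × List ℤ

def look (T : List (ℤ × ℤ)) (i : ℕ) : ℤ × ℤ := T.getD i (0, 0)
def lookF (F : List Form) (i : ℕ) : Form := F.getD i ([], [])

def closeB (f : List ℤ) (z0 : List ℤ) (t : ℤ) : Bool :=
  decide (nrm1 f ≤ 100) && decide (iabs (dotZ f z0 - 1000000000 * t) ≤ 1000000000)

theorem close_sound (z : List ℝ) (z0 : List ℤ)
    (hz : List.Forall₂ (fun (x : ℝ) (q : ℤ) => |10 ^ 12 * x - q| ≤ 10 ^ 6) z z0) (f : List ℤ)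
    (t : ℤ) (h : closeB f z0 t = true) : |1000 * dotR f z - t| ≤ 2 := by
  simp only [closeB, iabs_eq, Bool.and_eq_true, decide_eq_true_eq] at h
  have h1 := dot_approx z z0 hz f
  have h2 : (nrm1 f : ℝ) ≤ 100 := by exact_mod_cast h.1
  have h3 : |(dotZ f z0 : ℝ) - 10 ^ 9 * t| ≤ 10 ^ 9 := by
    have := h.2
    norm_num
    exact_mod_cast this
  rw [abs_le] at *
  constructor <;> linarith [h1.1, h1.2, h3.1, h3.2]

def matchL (d q : List ℤ) : Bool := decide (d = q) || decide (d = negL q)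

def matchE (f g q : Form) : Bool :=
  matchL (addL f.1 (negL g.1)) q.1 && matchL (addL f.2 (negL g.2)) q.2

theorem matchL_sound (z : List ℝ) (f g q : List ℤ) (h : matchL (addL f (negL g)) q = true) :
    (dotR f z - dotR g z) ^ 2 = dotR q z ^ 2 := by
  have e : dotR f z - dotR g z = dotR (addL f (negL g)) z := by
    rw [dotR_addL, dotR_negL]; ring
  simp only [matchL, Bool.or_eq_true, decide_eq_true_eq] at h
  rcases h with h | h <;> rw [e, h]
  rw [dotR_negL]; ring

def pairOk {n : ℕ} (T : List (ℤ × ℤ)) (e f : Fin n × Fin n) : Bool :=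
  decide (e ≠ f) && (decide (e.1 = f.1) || decide (e.1 = f.2) || decide (e.2 = f.1) ||
    decide (e.2 = f.2) || sep (look T e.1) (look T e.2) (look T f.1) (look T f.2))

theorem master (n : ℕ) (F : List Form) (T : List (ℤ × ℤ)) (z : List ℝ) (z0 : List ℤ)
    (L : List (Fin n × Fin n)) (Q : List Form)
    (hz : List.Forall₂ (fun (x : ℝ) (q : ℤ) => |10 ^ 12 * x - q| ≤ 10 ^ 6) z z0)
    (hQ : ∀ q ∈ Q, dotR q.1 z ^ 2 + dotR q.2 z ^ 2 = 1)
    (c1 : allN n (fun i => closeB (lookF F i).1 z0 (look T i).1 &&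
      closeB (lookF F i).2 z0 (look T i).2) = true)
    (c2 : allN n (fun i => allN i fun j => farB (look T i) (look T j)) = true)
    (c3 : L.Pairwise fun e f => pairOk T e f = true)
    (c4 : ∀ e ∈ L, e.1 < e.2 ∧ Q.any (fun q => matchE (lookF F e.1) (lookF F e.2) q) = true)
    (c5 : L.length = 2 * n)
    (c6 : ∀ v, (L.filter (fun e => decide (e.1 = v ∨ e.2 = v))).length = 4) :
    ∃ (P : Fin n → EuclideanSpace ℝ (Fin 2)) (E : Finset (Fin n × Fin n)),
      Function.Injective P ∧ (∀ e ∈ E, e.1 < e.2) ∧ E.card = 2 * n ∧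
      (∀ v : Fin n, (E.filter (fun e => e.1 = v ∨ e.2 = v)).card = 4) ∧
      (∀ e ∈ E, ∀ f ∈ E, e ≠ f → ∀ x ∈ segment ℝ (P e.1) (P e.2) ∩ segment ℝ (P f.1) (P f.2),
          (x = P e.1 ∨ x = P e.2) ∧ (x = P f.1 ∨ x = P f.2)) ∧
      (∀ e ∈ E, dist (P e.1) (P e.2) = 1) := by
  let P : Fin n → Pt := fun i => !₂[dotR (lookF F i).1 z, dotR (lookF F i).2 z]
  have hnear : ∀ i : Fin n, near (P i) (look T i) := by
    intro i
    have := allN_sound _ _ c1 i i.2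
    rw [Bool.and_eq_true] at this
    exact ⟨by simpa [P] using close_sound z z0 hz _ _ this.1,
      by simpa [P] using close_sound z z0 hz _ _ this.2⟩
  have hinj : Function.Injective P := by
    have h : ∀ i j : Fin n, j < i → P i ≠ P j := fun i j hij =>
      far_sound _ _ _ _ (hnear i) (hnear j)
        (allN_sound _ _ (allN_sound _ _ c2 i i.2) j hij)
    intro i j hij
    rcases lt_trichotomy i j with h1 | h1 | h1
    · exact absurd hij.symm (h j i h1)
    · exact h1
    · exact absurd hij (h i j h1)
  have hlt : ∀ e ∈ L, e.1 < e.2 := by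
    exact fun e he => (c4 e he).1
  have hdist : ∀ e ∈ L, dist (P e.1) (P e.2) = 1 := by
    intro e he
    have := c4 e he
    rw [List.any_eq_true] at this
    obtain ⟨-, q, hq, hm⟩ := this
    simp only [matchE, Bool.and_eq_true] at hm
    rw [EuclideanSpace.dist_eq, Fin.sum_univ_two, Real.dist_eq, Real.dist_eq, sq_abs, sq_abs]
    have h1 := matchL_sound z _ _ _ hm.1
    have h2 := matchL_sound z _ _ _ hm.2
    have : (P e.1 0 - P e.2 0) ^ 2 + (P e.1 1 - P e.2 1) ^ 2 = 1 := by
      simp only [P, Matrix.cons_val_zero, Matrix.cons_val_one]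
      rw [h1, h2]; exact hQ q hq
    rw [this, Real.sqrt_one]
  have hp := c3
  have hnd : L.Nodup := hp.imp (fun {e f} h => by
    simp only [pairOk, Bool.and_eq_true, decide_eq_true_eq] at h
    exact h.1)
  have hseg : ∀ e ∈ L, ∀ f ∈ L, e ≠ f →
      ∀ x ∈ segment ℝ (P e.1) (P e.2) ∩ segment ℝ (P f.1) (P f.2),
      (x = P e.1 ∨ x = P e.2) ∧ (x = P f.1 ∨ x = P f.2) := by
    have h := hp.imp_of_mem (S := fun e f =>
      ∀ x ∈ segment ℝ (P e.1) (P e.2) ∩ segment ℝ (P f.1) (P f.2),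
      (x = P e.1 ∨ x = P e.2) ∧ (x = P f.1 ∨ x = P f.2)) (by
        rintro ⟨a, b⟩ ⟨c, d⟩ he hf h x ⟨hx1, hx2⟩
        have de := hdist _ he
        have df := hdist _ hf
        simp only [pairOk, Bool.and_eq_true, Bool.or_eq_true, decide_eq_true_eq] at h
        simp only at hx1 hx2 de df h ⊢
        obtain ⟨hne, h⟩ := h
        rcases h with (((h | h) | h) | h) | h
        · subst h
          have hbd : P b ≠ P d := fun hh => hne (by rw [hinj hh])
          have := share_sound _ _ _ de df hbd x hx1 hx2
          exact ⟨Or.inl this, Or.inl this⟩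
        · subst h
          rw [segment_symm] at hx2
          rw [dist_comm] at df
          have hbd : P b ≠ P c := by
            intro hh
            have h1 := hlt _ he
            have h2 := hlt _ hf
            have := hinj hh
            subst this
            exact absurd h1 (not_lt_of_gt h2)
          have := share_sound _ _ _ de df hbd x hx1 hx2
          exact ⟨Or.inl this, Or.inr this⟩
        · subst h
          rw [segment_symm] at hx1
          rw [dist_comm] at de
          have hbd : P a ≠ P d := by
            intro hh
            have h1 := hlt _ he
            have h2 := hlt _ hf
            have := hinj hh
            subst this
            exact absurd h1 (not_lt_of_gt h2)
          have := share_sound _ _ _ de df hbd x hx1 hx2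
          exact ⟨Or.inr this, Or.inl this⟩
        · subst h
          rw [segment_symm] at hx1 hx2
          rw [dist_comm] at de df
          have hbd : P a ≠ P c := fun hh => hne (by rw [hinj hh])
          have := share_sound _ _ _ de df hbd x hx1 hx2
          exact ⟨Or.inr this, Or.inr this⟩
        · exact (sep_sound _ _ _ _ _ _ _ _ (hnear a) (hnear b) (hnear c) (hnear d) h x
            hx1 hx2).elim)
    intro e he f hf hef
    have : Std.Symm (fun e f : Fin n × Fin n =>
      ∀ x ∈ segment ℝ (P e.1) (P e.2) ∩ segment ℝ (P f.1) (P f.2),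
      (x = P e.1 ∨ x = P e.2) ∧ (x = P f.1 ∨ x = P f.2)) :=
      ⟨fun _ _ h x hx => (h x ⟨hx.2, hx.1⟩).symm⟩
    exact h.forall he hf hef
  refine ⟨P, L.toFinset, hinj, ?_, ?_, ?_, ?_, ?_⟩
  · intro e he; exact hlt e (List.mem_toFinset.1 he)
  · rw [List.toFinset_card_of_nodup hnd]; exact c5
  · intro v
    have := c6 v
    rw [← this, ← List.toFinset_card_of_nodup (hnd.filter _)]
    congr 1
    ext e
    simp
  · intro e he f hf; exact hseg e (List.mem_toFinset.1 he) f (List.mem_toFinset.1 hf)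
  · intro e he; exact hdist e (List.mem_toFinset.1 he)

theorem nk {N : ℕ} (X Y A : Fin N → Fin N → ℝ) (XA YA : Fin N → Fin N → ℝ) (z0 : Fin N → ℝ)
    (r : ℝ) (hr : 0 ≤ r)
    (hXA : ∀ j k, XA j k = ∑ i, X j i * A i k) (hYA : ∀ j k, YA j k = ∑ i, Y j i * A i k)
    (h0 : ∀ j, |(∑ i, X j i * z0 i) ^ 2 + (∑ i, Y j i * z0 i) ^ 2 - 1| ≤ r / 2)
    (h1 : ∀ j, ∑ k, |(if k = j then 1 else 0) - 2 * (∑ i, X j i * z0 i) * XA j k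
        - 2 * (∑ i, Y j i * z0 i) * YA j k|
        + 2 * r * ((∑ k, |XA j k|) ^ 2 + (∑ k, |YA j k|) ^ 2) ≤ 1 / 2) :
    ∃ z : Fin N → ℝ, (∀ j, (∑ i, X j i * z i) ^ 2 + (∑ i, Y j i * z i) ^ 2 = 1) ∧
      ∀ i, |z i - z0 i| ≤ r * ∑ k, |A i k| := by
  -- the map
  let g : (Fin N → ℝ) → (Fin N → ℝ) := fun y j =>
    y j - (((∑ i, X j i * z0 i) + ∑ k, XA j k * y k) ^ 2
      + ((∑ i, Y j i * z0 i) + ∑ k, YA j k * y k) ^ 2 - 1)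
  have absum : ∀ (c y : Fin N → ℝ) (b : ℝ), (∀ k, |y k| ≤ b) →
      |∑ k, c k * y k| ≤ (∑ k, |c k|) * b := by
    intro c y b hb
    calc |∑ k, c k * y k| ≤ ∑ k, |c k * y k| := Finset.abs_sum_le_sum_abs _ _
      _ ≤ ∑ k, |c k| * b := by
        apply Finset.sum_le_sum
        intro k _
        rw [abs_mul]
        exact mul_le_mul_of_nonneg_left (hb k) (abs_nonneg _)
      _ = _ := by rw [Finset.sum_mul]
  have lip : ∀ y y' : Fin N → ℝ, (∀ k, |y k| ≤ r) → (∀ k, |y' k| ≤ r) → ∀ b : ℝ,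
      (∀ k, |y k - y' k| ≤ b) → ∀ j, |g y j - g y' j| ≤ 1 / 2 * b := by
    intro y y' hy hy' b hb j
    have h1j := h1 j
    obtain ⟨x0, hx0⟩ : ∃ x, x = ∑ i, X j i * z0 i := ⟨_, rfl⟩
    obtain ⟨y0, hy0⟩ : ∃ x, x = ∑ i, Y j i * z0 i := ⟨_, rfl⟩
    rw [← hx0, ← hy0] at h1j
    have hb0 : 0 ≤ b := le_trans (abs_nonneg _) (hb j)
    have dX : ∑ k, XA j k * (y k - y' k) = ∑ k, XA j k * y k - ∑ k, XA j k * y' k := by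
      rw [← Finset.sum_sub_distrib]; exact Finset.sum_congr rfl fun k _ => by ring
    have dY : ∑ k, YA j k * (y k - y' k) = ∑ k, YA j k * y k - ∑ k, YA j k * y' k := by
      rw [← Finset.sum_sub_distrib]; exact Finset.sum_congr rfl fun k _ => by ring
    have aX : ∑ k, XA j k * (y k + y' k) = ∑ k, XA j k * y k + ∑ k, XA j k * y' k := by
      rw [← Finset.sum_add_distrib]; exact Finset.sum_congr rfl fun k _ => by ring
    have aY : ∑ k, YA j k * (y k + y' k) = ∑ k, YA j k * y k + ∑ k, YA j k * y' k := by
      rw [← Finset.sum_add_distrib]; exact Finset.sum_congr rfl fun k _ => by ring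
    have main : ∑ k, ((if k = j then 1 else 0) - 2 * x0 * XA j k - 2 * y0 * YA j k) * (y k - y' k)
        = (y j - y' j) - 2 * x0 * ∑ k, XA j k * (y k - y' k)
          - 2 * y0 * ∑ k, YA j k * (y k - y' k) := by
      rw [Finset.mul_sum, Finset.mul_sum]
      have : (y j - y' j) = ∑ k, (if k = j then (1:ℝ) else 0) * (y k - y' k) := by
        simp
      rw [this, ← Finset.sum_sub_distrib, ← Finset.sum_sub_distrib]
      exact Finset.sum_congr rfl fun k _ => by ring
    have e : g y j - g y' j =
        (∑ k, ((if k = j then 1 else 0) - 2 * x0 * XA j k - 2 * y0 * YA j k) * (y k - y' k))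
        - (∑ k, XA j k * (y k - y' k)) * (∑ k, XA j k * (y k + y' k))
        - (∑ k, YA j k * (y k - y' k)) * (∑ k, YA j k * (y k + y' k)) := by
      rw [main, dX, dY, aX, aY]
      simp only [g, ← hx0, ← hy0]
      ring
    have h2r : ∀ k, |y k + y' k| ≤ 2 * r := fun k =>
      le_trans (abs_add_le _ _) (by linarith [hy k, hy' k])
    have t1 := absum (fun k => (if k = j then 1 else 0) - 2 * x0 * XA j k - 2 * y0 * YA j k)
      (fun k => y k - y' k) b hb
    have t2 := absum (XA j) (fun k => y k - y' k) b hb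
    have t3 := absum (YA j) (fun k => y k - y' k) b hb
    have t4 := absum (XA j) (fun k => y k + y' k) (2 * r) h2r
    have t5 := absum (YA j) (fun k => y k + y' k) (2 * r) h2r
    have t6 := mul_le_mul t2 t4 (abs_nonneg _) (le_trans (abs_nonneg _) t2)
    have t7 := mul_le_mul t3 t5 (abs_nonneg _) (le_trans (abs_nonneg _) t3)
    rw [← abs_mul] at t6 t7
    have t8 := mul_le_mul_of_nonneg_right h1j hb0
    rw [e]
    refine le_trans (abs_sub _ _) ?_
    refine le_trans (add_le_add_left (abs_sub _ _) _) ?_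
    nlinarith [t1, t6, t7, t8]
  have gz : ∀ j, |g 0 j| ≤ r / 2 := by
    intro j
    have := h0 j
    simp only [g, Pi.zero_apply, mul_zero, Finset.sum_const_zero, add_zero, zero_sub, abs_neg]
    exact this
  have maps : ∀ y : Fin N → ℝ, (∀ k, |y k| ≤ r) → ∀ j, |g y j| ≤ r := by
    intro y hy j
    have := lip y 0 hy (fun k => by simpa using hr) r (fun k => by simpa using hy k) j
    have h3 := gz j
    have h4 : g y j = (g y j - g 0 j) + g 0 j := by ring
    rw [h4]
    refine le_trans (abs_add_le _ _) ?_
    linarith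
  have ex : ∃ y : Fin N → ℝ, (∀ k, |y k| ≤ r) ∧ g y = y := by
    have hmem : ∀ y : Fin N → ℝ, y ∈ Metric.closedBall (0 : Fin N → ℝ) r ↔ ∀ k, |y k| ≤ r := by
      intro y
      rw [mem_closedBall_zero_iff, pi_norm_le_iff_of_nonneg hr]
      rfl
    have hmt : Set.MapsTo g (Metric.closedBall 0 r) (Metric.closedBall 0 r) := by
      intro y hy
      rw [hmem] at hy ⊢
      exact maps y hy
    have hcon : ContractingWith (1/2 : NNReal) (hmt.restrict g _ _) := by
      refine ⟨by
        rw [← NNReal.coe_lt_coe]; norm_num, ?_⟩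
      refine LipschitzWith.of_dist_le_mul ?_
      intro y y'
      rw [Subtype.dist_eq, Subtype.dist_eq]
      have hnn : 0 ≤ ((1/2 : NNReal) : ℝ) * dist (y : Fin N → ℝ) y' := by positivity
      rw [dist_pi_le_iff hnn]
      intro j
      have := lip y y' ((hmem _).1 y.2) ((hmem _).1 y'.2) (dist (y : Fin N → ℝ) y')
        (fun k => by rw [← Real.dist_eq]; exact dist_le_pi_dist _ _ k) j
      rw [Real.dist_eq]
      simpa using this
    obtain ⟨y, hy, hf, -⟩ := hcon.exists_fixedPoint' (x := (0 : Fin N → ℝ))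
      (Metric.isClosed_closedBall.isComplete) hmt (Metric.mem_closedBall_self hr)
      (edist_ne_top _ _)
    exact ⟨y, (hmem y).1 hy, hf⟩
  obtain ⟨y, hy, hg⟩ := ex
  have lin : ∀ (B C : Fin N → Fin N → ℝ) (hBC : ∀ j k, C j k = ∑ i, B j i * A i k) (j : Fin N),
      ∑ i, B j i * (z0 i + ∑ k, A i k * y k) = ∑ i, B j i * z0 i + ∑ k, C j k * y k := by
    intro B C hBC j
    simp only [mul_add, Finset.sum_add_distrib, hBC, Finset.mul_sum, Finset.sum_mul]
    congr 1
    rw [Finset.sum_comm]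
    exact Finset.sum_congr rfl fun k _ => Finset.sum_congr rfl fun i _ => by ring
  refine ⟨fun i => z0 i + ∑ k, A i k * y k, ?_, ?_⟩
  · intro j
    have := congrFun hg j
    simp only [lin X XA hXA j, lin Y YA hYA j]
    simp only [g] at this
    linarith
  · intro i
    have := absum (A i) y r hy
    simp only [add_sub_cancel_left]
    linarith

theorem dotR_ofFn {N : ℕ} (f : List ℤ) (z : Fin N → ℝ) :
    dotR f (List.ofFn z) = ∑ i : Fin N, (f.getD i 0 : ℝ) * z i := by
  induction N generalizing f with
  | zero => simp [dotR_nil_right]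
  | succ N ih =>
    rw [List.ofFn_succ, Fin.sum_univ_succ]
    cases f with
    | nil => simp [dotR_nil_left]
    | cons a as => simp [dotR, ih]

theorem forall₂_ofFn {N : ℕ} (z : Fin N → ℝ) (z0 : List ℤ) (hl : z0.length = N)
    (R : ℝ → ℤ → Prop) (h : ∀ i : Fin N, R (z i) (z0.getD i 0)) :
    List.Forall₂ R (List.ofFn z) z0 := by
  rw [List.forall₂_iff_get]
  refine ⟨by simp [hl], ?_⟩
  intro i h1 h2
  have := h ⟨i, by simpa using h1⟩
  simpa [List.getD_eq_getElem?_getD, h2] using this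

def sumF (N : ℕ) (f : ℕ → ℤ) : ℤ := Nat.rec 0 (fun k s => s + f k) N

theorem sumF_cast (N : ℕ) (f : ℕ → ℤ) :
    ((sumF N f : ℤ) : ℝ) = ∑ i : Fin N, (f i : ℝ) := by
  induction N with
  | zero => simp [sumF]
  | succ N ih =>
    rw [Fin.sum_univ_castSucc]
    simp only [Fin.val_castSucc, Fin.val_last]
    rw [← ih]
    exact Int.cast_add _ _

def ent (M : List (List ℤ)) (i j : ℕ) : ℤ := (M.getD i []).getD j 0

def nkCheck (N : ℕ) (X Y A XA YA : List (List ℤ)) (xz yz : List ℤ) (z0 : List ℤ) : Bool :=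
  allN N fun j =>
    decide (xz.getD j 0 = sumF N fun i => ent X j i * z0.getD i 0) &&
    decide (yz.getD j 0 = sumF N fun i => ent Y j i * z0.getD i 0) &&
    (allN N fun k =>
      decide (ent XA j k = sumF N fun i => ent X j i * ent A i k) &&
      decide (ent YA j k = sumF N fun i => ent Y j i * ent A i k)) &&
    decide (2000000000 * iabs (xz.getD j 0 * xz.getD j 0 + yz.getD j 0 * yz.getD j 0 -
      1000000000000000000000000) ≤ 1000000000000000000000000) &&
    decide (20000000000000 * (sumF N fun k =>
        iabs ((bif Nat.beq k j then 10000000000000000 else 0) - 2 * xz.getD j 0 * ent XA j k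
          - 2 * yz.getD j 0 * ent YA j k)) +
      4000000000000 * ((sumF N fun k => iabs (ent XA j k)) ^ 2 +
        (sumF N fun k => iabs (ent YA j k)) ^ 2) ≤ 100000000000000000000000000000) &&
    decide (sumF N (fun k => iabs (ent A j k)) ≤ 10000000)

theorem nkL (N : ℕ) (Q : List Form) (A XA YA : List (List ℤ)) (xz yz z0 : List ℤ)
    (hl : decide (z0.length = N ∧ Q.length = N) = true)
    (hc : nkCheck N (Q.map Prod.fst) (Q.map Prod.snd) A XA YA xz yz z0 = true) :
    ∃ z : List ℝ, List.Forall₂ (fun (x : ℝ) (q : ℤ) => |10 ^ 12 * x - q| ≤ 10 ^ 6) z z0 ∧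
      ∀ q ∈ Q, dotR q.1 z ^ 2 + dotR q.2 z ^ 2 = 1 := by
  obtain ⟨hlz, hlQ⟩ := of_decide_eq_true hl
  replace hc := fun j : Fin N => allN_sound _ _ hc j j.2
  simp only [iabs_eq, Bool.and_eq_true, decide_eq_true_eq] at hc
  set X := Q.map Prod.fst
  set Y := Q.map Prod.snd
  have hx : ∀ j : Fin N, ∑ i : Fin N, (ent X j i : ℝ) * ((z0.getD i 0 : ℝ) / 10 ^ 12)
      = (xz.getD j 0 : ℝ) / 10 ^ 12 := by
    intro j
    rw [(hc j).1.1.1.1.1, sumF_cast, Finset.sum_div]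
    exact Finset.sum_congr rfl fun i _ => by push_cast; ring
  have hy : ∀ j : Fin N, ∑ i : Fin N, (ent Y j i : ℝ) * ((z0.getD i 0 : ℝ) / 10 ^ 12)
      = (yz.getD j 0 : ℝ) / 10 ^ 12 := by
    intro j
    rw [(hc j).1.1.1.1.2, sumF_cast, Finset.sum_div]
    exact Finset.sum_congr rfl fun i _ => by push_cast; ring
  have hxa : ∀ j k : Fin N, ent XA j k = (sumF N fun i => ent X j i * ent A i k) ∧
      ent YA j k = sumF N fun i => ent Y j i * ent A i k := by
    intro j k
    have := allN_sound _ _ (hc j).1.1.1.2 k k.2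
    simpa only [Bool.and_eq_true, decide_eq_true_eq] using this
  have absd : ∀ (c : ℝ) (f : ℕ → ℤ), 0 < c →
      ∑ k : Fin N, |(f k : ℝ) / c| = ((sumF N fun k => |f k| : ℤ) : ℝ) / c := by
    intro c f hc
    rw [sumF_cast, Finset.sum_div]
    exact Finset.sum_congr rfl fun i _ => by rw [abs_div, abs_of_pos hc, Int.cast_abs]
  obtain ⟨z, hz1, hz2⟩ := nk (N := N) (fun j i => (ent X j i : ℝ)) (fun j i => (ent Y j i : ℝ))
    (fun i k => (ent A i k : ℝ) / 10 ^ 4) (fun i k => (ent XA i k : ℝ) / 10 ^ 4)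
    (fun i k => (ent YA i k : ℝ) / 10 ^ 4) (fun i => (z0.getD i 0 : ℝ) / 10 ^ 12)
    (1 / 10 ^ 9) (by norm_num)
    (by
      intro j k
      rw [(hxa j k).1, sumF_cast, Finset.sum_div]
      exact Finset.sum_congr rfl fun i _ => by push_cast; ring)
    (by
      intro j k
      rw [(hxa j k).2, sumF_cast, Finset.sum_div]
      exact Finset.sum_congr rfl fun i _ => by push_cast; ring)
    (by
      intro j
      simp only [hx, hy]
      have h := (hc j).1.1.2
      have h' : 2 * 10 ^ 9 * |(xz.getD j 0 : ℝ) ^ 2 + (yz.getD j 0 : ℝ) ^ 2 - 10 ^ 24| ≤ 10 ^ 24 := by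
        rw [sq, sq]
        norm_num
        exact_mod_cast h
      have e : ((xz.getD j 0 : ℝ) / 10 ^ 12) ^ 2 + ((yz.getD j 0 : ℝ) / 10 ^ 12) ^ 2 - 1
        = ((xz.getD j 0 : ℝ) ^ 2 + (yz.getD j 0 : ℝ) ^ 2 - 10 ^ 24) / 10 ^ 24 := by
        ring
      rw [e, abs_div, abs_of_pos (show (0:ℝ) < 10 ^ 24 by norm_num)]
      rw [div_le_iff₀ (by norm_num)]
      generalize |(xz.getD j 0 : ℝ) ^ 2 + (yz.getD j 0 : ℝ) ^ 2 - 10 ^ 24| = a at h' ⊢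
      norm_num at h' ⊢
      linarith)
    (by
      intro j
      simp only [hx, hy]
      have h := (hc j).1.2
      have e : ∀ k : Fin N, (if k = j then (1:ℝ) else 0)
          - 2 * ((xz.getD j 0 : ℝ) / 10 ^ 12) * ((ent XA j k : ℝ) / 10 ^ 4)
          - 2 * ((yz.getD j 0 : ℝ) / 10 ^ 12) * ((ent YA j k : ℝ) / 10 ^ 4)
          = (((bif Nat.beq k j then 10000000000000000 else 0) - 2 * xz.getD j 0 * ent XA j k
          - 2 * yz.getD j 0 * ent YA j k : ℤ) : ℝ) / 10 ^ 16 := by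
        intro k
        by_cases hk : k = j
        · subst hk; simp; ring
        · have hk' : ¬ ((k : ℕ) = j) := fun hh => hk (Fin.ext hh)
          have hb : Nat.beq k j = false := by
            rw [Bool.eq_false_iff]; exact fun hh => hk' (Nat.eq_of_beq_eq_true hh)
          simp only [if_neg hk, hb, cond_false]; push_cast; ring
      rw [Finset.sum_congr rfl fun k _ => congrArg abs (e k)]
      rw [absd (10 ^ 16) (fun k => (bif Nat.beq k j then 10000000000000000 else 0)
          - 2 * xz.getD j 0 * ent XA j k - 2 * yz.getD j 0 * ent YA j k) (by norm_num),
        absd (10 ^ 4) (fun k => ent XA j k) (by norm_num),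
        absd (10 ^ 4) (fun k => ent YA j k) (by norm_num)]
      generalize (sumF N fun k =>
        |(bif Nat.beq k j then 10000000000000000 else 0) - 2 * xz.getD j 0 * ent XA j k
          - 2 * yz.getD j 0 * ent YA j k|) = a at *
      generalize (sumF N fun k => |ent XA j k|) = b at *
      generalize (sumF N fun k => |ent YA j k|) = c at *
      have h' : 2 * 10 ^ 9 * 10 ^ 4 * (a : ℝ) + 4 * 10 ^ 12 * ((b : ℝ) ^ 2 + (c : ℝ) ^ 2)
        ≤ 10 ^ 29 := by
        norm_num
        exact_mod_cast h
      have e2 : (a : ℝ) / 10 ^ 16 + 2 * (1 / 10 ^ 9) * (((b : ℝ) / 10 ^ 4) ^ 2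
          + ((c : ℝ) / 10 ^ 4) ^ 2) = (2 * 10 ^ 9 * 10 ^ 4 * (a : ℝ)
          + 4 * 10 ^ 12 * ((b : ℝ) ^ 2 + (c : ℝ) ^ 2)) / (2 * 10 ^ 29) := by ring
      rw [e2, div_le_iff₀ (by norm_num)]
      linarith)
  refine ⟨List.ofFn z, forall₂_ofFn z z0 hlz _ ?_, ?_⟩
  · intro i
    have h1 := hz2 i
    rw [absd (10 ^ 4) (fun k => ent A i k) (by norm_num)] at h1
    have h2 : ((sumF N fun k => |ent A i k| : ℤ) : ℝ) ≤ 10 ^ 7 := by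
      have := (hc i).2
      norm_num
      exact_mod_cast this
    have e : 10 ^ 12 * z i - (z0.getD i 0 : ℝ) = 10 ^ 12 * (z i - (z0.getD i 0 : ℝ) / 10 ^ 12) := by
      ring
    rw [e, abs_mul, abs_of_pos (show (0:ℝ) < 10 ^ 12 by norm_num)]
    linarith
  · intro q hq
    obtain ⟨j, hj, rfl⟩ := List.getElem_of_mem hq
    have := hz1 ⟨j, hlQ ▸ hj⟩
    rw [dotR_ofFn, dotR_ofFn]
    simpa [ent, X, Y, List.getD_eq_getElem?_getD, hj] using this
def Q52 : List Form := [
  ([3, -1, 0, 0, 0, 0, 0, 0, 0, 0, 0], [0, 0, 1, 0, 0, 0, 0, 0, 0, 0, 0]),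
  ([3, -2, 0, 0, 1, 0, 0, 0, 0, 0, 0], [0, 0, 0, 0, 0, 1, 0, 0, 0, 0, 0]),
  ([0, 1, 0, 0, -1, 0, 0, 0, 0, 0, 0], [0, 0, 1, 0, 0, -1, 0, 0, 0, 0, 0]),
  ([1, 0, 0, 0, 0, 0, 0, 0, 0, 0, 0], [0, 0, 2, -1, 0, 0, 0, 0, 0, 0, 0]),
  ([3, 0, 0, 0, 0, 0, -1, 0, 0, 0, 0], [0, 0, 2, 0, 0, 0, 0, -1, 0, 0, 0]),
  ([2, 0, 0, 0, 0, 0, -1, 0, 0, 0, 0], [0, 0, 0, 1, 0, 0, 0, -1, 0, 0, 0]),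
  ([3, -2, 0, 0, 2, 0, 0, 0, -1, 0, 0], [0, 0, 0, 0, 0, 2, 0, 0, 0, -1, 0]),
  ([3, -2, 0, 0, 2, 0, 0, 0, 0, 0, -1], [0, 0, 0, 0, 0, 2, 0, 0, 0, 0, 0]),
  ([0, 0, 0, 0, 0, 0, 1, 0, -1, 0, 0], [0, 0, 0, 0, 0, 0, 0, 1, 0, -1, 0]),
  ([0, 0, 0, 0, 0, 0, 0, 0, 1, 0, -1], [0, 0, 0, 0, 0, 0, 0, 0, 0, 1, 0]),
  ([0, 0, 0, 0, 0, 0, 0, 0, 1, 0, 0], [0, 0, 4, -1, 0, 0, 0, -2, 0, 1, 0])]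

def z52 : List ℤ := [
  920053918189, 3190803323092, 902523040957, 2196837847556, 2624516226384, 78314982211,
  1960833173433, 1204151898732, 998113354619, 933651343348, 639930204452]

def A52 : List (List ℤ) := [
  [-662, 286, -431, 901, 1669, -443, 219, -119, 1441, 328, 1411],
  [467, 4814, -3343, 1418, 3808, -845, 2049, 165, 3268, -455, 4608],
  [4369, -1887, 978, 614, 572, -231, -664, -249, 504, 687, -179],
  [10294, -4446, 2968, 11872, -2775, 578, -1843, -219, -2377, 603, -3671],
  [3121, 3667, -5667, 244, 2714, -403, 3320, 642, 2304, -1770, 4951],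
  [2546, -1100, -3492, 1420, 1324, -535, -1537, -577, 1166, 1590, -415],
  [-3002, 1297, -1955, -4703, 1835, 1461, 994, -539, 6534, 1487, 6396],
  [10090, -4358, 2836, 11081, -2958, -4173, -1775, -255, -1933, 704, -3237],
  [-686, 296, -447, -1879, 734, 397, 227, -123, 560, 340, 5571],
  [1847, -798, -2533, 1030, 960, -388, 953, -1736, 846, 4787, -301],
  [4128, -1783, -7049, 806, 3238, -614, 2711, -4649, 2765, -1141, 4786]]

def XA52 : List (List ℤ) := [
  [-2453, -3956, 2050, 1285, 1199, -484, -1392, -522, 1055, 1439, -375],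
  [201, -5103, -274, 111, 105, -42, -121, -45, 91, 124, -32],
  [-2654, 1147, 2324, 1174, 1094, -442, -1271, -477, 964, 1315, -343],
  [-662, 286, -431, 901, 1669, -443, 219, -119, 1441, 328, 1411],
  [1016, -439, 662, 7406, 3172, -2790, -337, 182, -2211, -503, -2163],
  [1678, -725, 1093, 6505, 1503, -2347, -556, 301, -3652, -831, -3574],
  [4008, -1732, -5494, 2234, 2085, -842, 2972, 720, 1835, -1986, -652],
  [-806, 347, 1108, -451, -419, 169, 488, 5246, -370, -505, 133],
  [-2316, 1001, -1508, -2824, 1101, 1064, 767, -416, 5974, 1147, 825],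
  [-4814, 2079, 6602, -2685, -2504, 1011, -2484, 4526, -2205, 1481, 785],
  [-686, 296, -447, -1879, 734, 397, 227, -123, 560, 340, 5571]]

def YA52 : List (List ℤ) := [
  [4369, -1887, 978, 614, 572, -231, -664, -249, 504, 687, -179],
  [2546, -1100, -3492, 1420, 1324, -535, -1537, -577, 1166, 1590, -415],
  [1823, -787, 4470, -806, -752, 304, 873, 328, -662, -903, 236],
  [-1556, 672, -1012, -10644, 3919, -1040, 515, -279, 3385, 771, 3313],
  [-1352, 584, -880, -9853, 4102, 3711, 447, -243, 2941, 670, 2879],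
  [204, -88, 132, 791, 183, 4751, -68, 36, -444, -101, -434],
  [3245, -1402, -4451, 1810, 1688, -682, -4027, 582, 1486, -1607, -529],
  [5092, -2200, -6984, 2840, 2648, -1070, -3074, -1154, 2332, 3180, -830],
  [8243, -3560, 5369, 10051, -3918, -3785, -2728, 1481, -2779, -4083, -2936],
  [1847, -798, -2533, 1030, 960, -388, 953, -1736, 846, 4787, -301],
  [-11151, 4816, -7261, -30548, 11939, 6456, 3690, -2003, 9105, 5524, 9128]]

def xz52 : List ℤ := [
  -430641568525, -996928665233, 566287096708, 920053918189, 799328581134, -120725337055,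
  629474206532, 987657356699, 962719818814, 358183150167, 998113354619]

def yz52 : List ℤ := [
  902523040957, 78314982211, 824208058746, -391791765642, 600894183182, 992685948824,
  -777021378926, 156629964422, 270500555384, 933651343348, -61398137844]

def Q54 : List Form := [
  ([3, -1, 0, 0, 0, 0, 0, 0, 0], [0, 0, 1, 0, 0, 0, 0, 0, 0]),
  ([3, -2, 0, 0, 1, 0, 0, 0, 0], [0, 0, 0, 0, 0, 1, 0, 0, 0]),
  ([0, 1, 0, 0, -1, 0, 0, 0, 0], [0, 0, 1, 0, 0, -1, 0, 0, 0]),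
  ([1, 0, 0, 0, 0, 0, 0, 0, 0], [0, 0, 2, -1, 0, 0, 0, 0, 0]),
  ([3, 0, 0, 0, 0, 0, -1, 0, 0], [0, 0, 2, 0, 0, 0, 0, -1, 0]),
  ([2, 0, 0, 0, 0, 0, -1, 0, 0], [0, 0, 0, 1, 0, 0, 0, -1, 0]),
  ([3, -2, 0, 0, 2, 0, 0, 0, -1], [0, 0, 4, -1, 0, 4, 0, -2, 0]),
  ([0, 0, 0, 0, 0, 0, 0, 0, 1], [0, 0, 0, 0, 0, 2, 0, 0, 0]),
  ([0, 0, 0, 0, 0, 0, 1, 0, -1], [0, 0, 4, -1, 0, 2, 0, -1, 0])]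

def z54 : List ℤ := [
  915782422764, 3192772392670, 895319193681, 2192313074336, 2640115788636, 61910123645,
  1941595573933, 1198384888396, 992304664083]

def A54 : List (List ℤ) := [
  [-604, 269, 153, 1745, 1135, -587, 272, 1165, 1031],
  [-498, 5232, -3827, -778, 4547, -283, 2391, 5289, 3892],
  [4932, -2201, 2132, 2991, -568, -735, -784, -893, -397],
  [11239, -5016, 3915, 14453, -3724, -132, -2187, -4441, -3145],
  [1057, 4538, -8172, -6375, 5609, 1092, 3858, 6960, 4635],
  [3901, -1741, -986, 6703, -1273, -1647, -1756, -2001, -890],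
  [-2700, 1205, 683, -654, -660, 794, 1216, 5211, 4614],
  [11074, -4942, 3957, 13994, -4048, -4945, -2113, -4122, -2863],
  [-973, 434, 246, -1673, 318, 411, 438, 5538, 222]]

def XA54 : List (List ℤ) := [
  [-1314, -4425, 4286, 6013, -1142, -1478, -1575, -1794, -799],
  [241, -5119, -59, 416, -80, -103, -108, -123, -56],
  [-1555, 694, 4345, 5597, -1062, -1375, -1467, -1671, -743],
  [-604, 269, 153, 1745, 1135, -587, 272, 1165, 1031],
  [888, -398, -224, 5889, 4065, -2555, -400, -1716, -1521],
  [1492, -667, -377, 4144, 2930, -1968, -672, -2881, -2552],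
  [2271, -1015, -8477, -4286, 5211, 578, 3312, 1299, 4357],
  [-973, 434, 246, -1673, 318, 411, 438, 5538, 222],
  [-1727, 771, 437, 1019, -978, 383, 778, -327, 4392]]

def YA54 : List (List ℤ) := [
  [4932, -2201, 2132, 2991, -568, -735, -784, -893, -397],
  [3901, -1741, -986, 6703, -1273, -1647, -1756, -2001, -890],
  [1031, -460, 3118, -3712, 705, 912, 972, 1108, 493],
  [-1375, 614, 349, -8471, 2588, -1338, 619, 2655, 2351],
  [-1210, 540, 307, -8012, 2912, 3475, 545, 2336, 2069],
  [165, -74, -42, 459, 324, 4813, -74, -319, -282],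
  [1945, -868, -7245, -3665, 4456, 494, -3747, 1109, 3723],
  [7802, -3482, -1972, 13406, -2546, -3294, -3512, -4002, -1780],
  [5217, -2328, -1316, -3077, 2954, -1157, -2348, 989, 2640]]

def xz54 : List ℤ := [
  -445425124378, -998081728412, 552656604034, 915782422764, 805751694359, -110030728405,
  649729396141, 992304664083, 949290909850]

def yz54 : List ℤ := [
  895319193681, 61910123645, 833409070036, -401674686974, 592253498966, 993928185940,
  -760165581824, 123820247290, 314399059282]

def W52 : List Form := [
  ([-3, 2, 0, 0, 0, 0, 0, 0, 0, 0, 0], []),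
  ([0, 1, 0, 0, 0, 0, 0, 0, 0, 0, 0], [0, 0, 1, 0, 0, 0, 0, 0, 0, 0, 0]),
  ([3, 0, 0, 0, 0, 0, 0, 0, 0, 0, 0], [0, 0, 2, 0, 0, 0, 0, 0, 0, 0, 0]),
  ([2, 0, 0, 0, 0, 0, 0, 0, 0, 0, 0], [0, 0, 0, 1, 0, 0, 0, 0, 0, 0, 0]),
  ([1, 0, 0, 0, 0, 0, 0, 0, 0, 0, 0], [0, 0, -2, 2, 0, 0, 0, 0, 0, 0, 0]),
  ([], [0, 0, -4, 3, 0, 0, 0, 0, 0, 0, 0]),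
  ([0, 0, 0, 0, 1, 0, 0, 0, 0, 0, 0], [0, 0, 0, 0, 0, 1, 0, 0, 0, 0, 0]),
  ([3, -1, 0, 0, 1, 0, 0, 0, 0, 0, 0], [0, 0, 1, 0, 0, 1, 0, 0, 0, 0, 0]),
  ([3, -2, 0, 0, 2, 0, 0, 0, 0, 0, 0], [0, 0, 0, 0, 0, 2, 0, 0, 0, 0, 0]),
  ([0, 0, 0, 0, 0, 0, 1, 0, 0, 0, 0], [0, 0, 0, 0, 0, 0, 0, 1, 0, 0, 0]),
  ([0, 0, 0, 0, 0, 0, 0, 0, 1, 0, 0], [0, 0, 0, 0, 0, 0, 0, 0, 0, 1, 0]),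
  ([0, 0, 0, 0, 0, 0, 0, 0, 0, 0, 1], []),
  ([-1, 0, 0, 0, 0, 0, 1, 0, 0, 0, 0], [0, 0, -2, 1, 0, 0, 0, 1, 0, 0, 0]),
  ([-2, 0, 0, 0, 0, 0, 1, 0, 0, 0, 0], [0, 0, -4, 2, 0, 0, 0, 1, 0, 0, 0]),
  ([], [0, 0, -4, 1, 0, 0, 0, 2, 0, 0, 0])]

def T52 : List (ℤ × ℤ) := [
  (3621, 0), (3191, 903), (2760, 1805), (1840, 2197), (920, 2589), (0, 2980), (2625, 78),
  (2194, 981), (1628, 157), (1961, 1204), (998, 934), (640, 0), (1041, 1596), (121, 1988),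
  (0, 995)]

def L52 : List (ℕ × ℕ) := [
  (0, 2), (0, 3), (0, 20), (0, 21), (1, 4), (1, 5), (1, 22), (1, 23), (2, 6), (2, 20), (2, 24),
  (3, 7), (3, 21), (3, 25), (4, 8), (4, 22), (4, 26), (5, 9), (5, 23), (5, 27), (6, 10), (6, 24),
  (6, 32), (7, 11), (7, 25), (7, 33), (8, 12), (8, 26), (8, 34), (9, 13), (9, 27), (9, 35),
  (10, 14), (10, 32), (10, 42), (11, 15), (11, 33), (11, 43), (12, 16), (12, 34), (12, 44),
  (13, 17), (13, 35), (13, 45), (14, 18), (14, 42), (14, 46), (15, 19), (15, 43), (15, 47),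
  (16, 19), (16, 44), (16, 48), (17, 18), (17, 45), (17, 49), (18, 46), (18, 49), (19, 47),
  (19, 48), (20, 24), (20, 28), (21, 25), (21, 29), (22, 26), (22, 30), (23, 27), (23, 31),
  (24, 28), (25, 29), (26, 30), (27, 31), (28, 36), (28, 40), (29, 37), (29, 40), (30, 38),
  (30, 41), (31, 39), (31, 41), (32, 36), (32, 42), (33, 37), (33, 43), (34, 38), (34, 44),
  (35, 39), (35, 45), (36, 40), (36, 50), (37, 40), (37, 51), (38, 41), (38, 51), (39, 41),
  (39, 50), (42, 46), (43, 47), (44, 48), (45, 49), (46, 50), (47, 51), (48, 51), (49, 50)]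

def W54 : List Form := [
  ([-3, 2, 0, 0, 0, 0, 0, 0, 0], []), ([0, 1, 0, 0, 0, 0, 0, 0, 0], [0, 0, 1, 0, 0, 0, 0, 0, 0]),
  ([3, 0, 0, 0, 0, 0, 0, 0, 0], [0, 0, 2, 0, 0, 0, 0, 0, 0]),
  ([2, 0, 0, 0, 0, 0, 0, 0, 0], [0, 0, 0, 1, 0, 0, 0, 0, 0]),
  ([1, 0, 0, 0, 0, 0, 0, 0, 0], [0, 0, -2, 2, 0, 0, 0, 0, 0]), ([], [0, 0, -4, 3, 0, 0, 0, 0, 0]),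
  ([0, 0, 0, 0, 1, 0, 0, 0, 0], [0, 0, 0, 0, 0, 1, 0, 0, 0]),
  ([3, -1, 0, 0, 1, 0, 0, 0, 0], [0, 0, 1, 0, 0, 1, 0, 0, 0]),
  ([3, -2, 0, 0, 2, 0, 0, 0, 0], [0, 0, 0, 0, 0, 2, 0, 0, 0]),
  ([0, 0, 0, 0, 0, 0, 1, 0, 0], [0, 0, 0, 0, 0, 0, 0, 1, 0]),
  ([0, 0, 0, 0, 0, 0, 0, 0, 1], [0, 0, -4, 1, 0, -2, 0, 2, 0]),
  ([], [0, 0, -4, 1, 0, -4, 0, 2, 0]), ([3, -2, 0, 0, 2, 0, 0, 0, -1], []),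
  ([-1, 0, 0, 0, 0, 0, 1, 0, 0], [0, 0, -2, 1, 0, 0, 0, 1, 0]),
  ([-2, 0, 0, 0, 0, 0, 1, 0, 0], [0, 0, -4, 2, 0, 0, 0, 1, 0]), ([], [0, 0, -4, 1, 0, 0, 0, 2, 0])]

def T54 : List (ℤ × ℤ) := [
  (3638, 0), (3193, 895), (2747, 1791), (1832, 2192), (916, 2594), (0, 2996), (2640, 62),
  (2195, 957), (1642, 124), (1942, 1198), (992, 884), (0, 760), (650, 0), (1026, 1600),
  (110, 2002), (0, 1008)]

def L54 : List (ℕ × ℕ) := [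
  (0, 2), (0, 3), (0, 20), (0, 21), (1, 4), (1, 5), (1, 22), (1, 23), (2, 6), (2, 20), (2, 24),
  (3, 7), (3, 21), (3, 25), (4, 8), (4, 22), (4, 26), (5, 9), (5, 23), (5, 27), (6, 10), (6, 24),
  (6, 32), (7, 11), (7, 25), (7, 33), (8, 12), (8, 26), (8, 34), (9, 13), (9, 27), (9, 35),
  (10, 14), (10, 32), (10, 44), (11, 15), (11, 33), (11, 45), (12, 16), (12, 34), (12, 46),
  (13, 17), (13, 35), (13, 47), (14, 18), (14, 44), (14, 48), (15, 19), (15, 45), (15, 49),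
  (16, 19), (16, 46), (16, 50), (17, 18), (17, 47), (17, 51), (18, 48), (18, 51), (19, 49),
  (19, 50), (20, 24), (20, 28), (21, 25), (21, 29), (22, 26), (22, 30), (23, 27), (23, 31),
  (24, 28), (25, 29), (26, 30), (27, 31), (28, 36), (28, 42), (29, 37), (29, 42), (30, 38),
  (30, 43), (31, 39), (31, 43), (32, 36), (32, 44), (33, 37), (33, 45), (34, 38), (34, 46),
  (35, 39), (35, 47), (36, 40), (36, 52), (37, 41), (37, 53), (38, 41), (38, 53), (39, 40),
  (39, 52), (40, 42), (40, 43), (41, 42), (41, 43), (44, 48), (45, 49), (46, 50), (47, 51),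
  (48, 52), (49, 53), (50, 53), (51, 52)]

def W64 : List Form := [
  ([-2, 2, 0, 0, 0, 0, 0, 0, 0, 0, 0], []),
  ([1, 1, 0, 0, 0, 0, 0, 0, 0, 0, 0], [0, 0, 1, 0, 0, 0, 0, 0, 0, 0, 0]),
  ([4, 0, 0, 0, 0, 0, 0, 0, 0, 0, 0], [0, 0, 2, 0, 0, 0, 0, 0, 0, 0, 0]),
  ([3, 0, 0, 0, 0, 0, 0, 0, 0, 0, 0], [0, 0, 0, 1, 0, 0, 0, 0, 0, 0, 0]),
  ([2, 0, 0, 0, 0, 0, 0, 0, 0, 0, 0], [0, 0, -2, 2, 0, 0, 0, 0, 0, 0, 0]),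
  ([1, 0, 0, 0, 0, 0, 0, 0, 0, 0, 0], [0, 0, -4, 3, 0, 0, 0, 0, 0, 0, 0]),
  ([], [0, 0, -2, 2, 0, 0, 0, 0, 0, 0, 0]),
  ([1, 0, 0, 0, 1, 0, 0, 0, 0, 0, 0], [0, 0, 0, 0, 0, 1, 0, 0, 0, 0, 0]),
  ([4, -1, 0, 0, 1, 0, 0, 0, 0, 0, 0], [0, 0, 1, 0, 0, 1, 0, 0, 0, 0, 0]),
  ([4, -2, 0, 0, 2, 0, 0, 0, 0, 0, 0], [0, 0, 0, 0, 0, 2, 0, 0, 0, 0, 0]),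
  ([1, 0, 0, 0, 0, 0, 1, 0, 0, 0, 0], [0, 0, 0, 0, 0, 0, 0, 1, 0, 0, 0]),
  ([1, 0, 0, 0, 0, 0, 0, 0, 1, 0, 0], [0, 0, 0, 0, 0, 0, 0, 0, 0, 1, 0]),
  ([1, 0, 0, 0, 0, 0, 0, 0, 0, 0, 1], []),
  ([0, 0, 0, 0, 0, 0, 1, 0, 0, 0, 0], [0, 0, -2, 1, 0, 0, 0, 1, 0, 0, 0]),
  ([-1, 0, 0, 0, 0, 0, 1, 0, 0, 0, 0], [0, 0, -4, 2, 0, 0, 0, 1, 0, 0, 0]),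
  ([1, 0, 0, 0, 0, 0, 0, 0, 0, 0, 0], [0, 0, -4, 1, 0, 0, 0, 2, 0, 0, 0]),
  ([3, 0, 0, 0, 0, 0, -1, 0, 0, 0, 0], [0, 0, -4, 2, 0, 0, 0, 1, 0, 0, 0]),
  ([], [0, 0, -6, 2, 0, 0, 0, 2, 0, 0, 0])]

def T64 : List (ℤ × ℤ) := [
  (4541, 0), (4111, 903), (3680, 1805), (2760, 2197), (1840, 2589), (920, 2980), (0, 2589),
  (3545, 78), (3114, 981), (2548, 157), (2881, 1204), (1918, 934), (1560, 0), (1961, 1596),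
  (1041, 1988), (920, 995), (799, 1988), (0, 1387)]

def L64 : List (ℕ × ℕ) := [
  (0, 2), (0, 3), (0, 24), (0, 25), (1, 4), (1, 5), (1, 26), (1, 27), (2, 6), (2, 24), (2, 28),
  (3, 7), (3, 25), (3, 29), (4, 8), (4, 26), (4, 30), (5, 9), (5, 27), (5, 31), (6, 10), (6, 28),
  (6, 36), (7, 11), (7, 29), (7, 37), (8, 12), (8, 30), (8, 38), (9, 13), (9, 31), (9, 39),
  (10, 14), (10, 36), (10, 46), (11, 15), (11, 37), (11, 47), (12, 16), (12, 38), (12, 48),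
  (13, 17), (13, 39), (13, 49), (14, 18), (14, 46), (14, 50), (15, 19), (15, 47), (15, 51),
  (16, 20), (16, 48), (16, 52), (17, 21), (17, 49), (17, 53), (18, 22), (18, 50), (18, 58),
  (19, 23), (19, 51), (19, 59), (20, 23), (20, 52), (20, 60), (21, 22), (21, 53), (21, 61),
  (22, 58), (22, 61), (23, 59), (23, 60), (24, 28), (24, 32), (25, 29), (25, 33), (26, 30),
  (26, 34), (27, 31), (27, 35), (28, 32), (29, 33), (30, 34), (31, 35), (32, 40), (32, 44),
  (33, 41), (33, 44), (34, 42), (34, 45), (35, 43), (35, 45), (36, 40), (36, 46), (37, 41),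
  (37, 47), (38, 42), (38, 48), (39, 43), (39, 49), (40, 44), (40, 54), (41, 44), (41, 55),
  (42, 45), (42, 56), (43, 45), (43, 57), (46, 50), (47, 51), (48, 52), (49, 53), (50, 54),
  (51, 55), (52, 56), (53, 57), (54, 58), (54, 62), (55, 59), (55, 63), (56, 60), (56, 63),
  (57, 61), (57, 62), (58, 62), (59, 63), (60, 63), (61, 62)]

def F57 : List Form := [
  ([20, 12], []), ([-10, -6], [0, 0, 30, 18]), ([-10, -6], [0, 0, -30, -18]),
  ([20, 12], [0, 0, 24, 0]), ([20, 12], [0, 0, -24, 0]), ([-22, -6], [0, 0, 18, 18]),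
  ([2, -6], [0, 0, 42, 18]), ([2, -6], [0, 0, -42, -18]), ([-22, -6], [0, 0, -18, -18]),
  ([17, 9], [0, 0, 21, 9]), ([17, 9], [0, 0, -21, -9]), ([-19, -9], [0, 0, 15, 9]),
  ([2, 0], [0, 0, 36, 18]), ([2, 0], [0, 0, -36, -18]), ([-19, -9], [0, 0, -15, -9]),
  ([14, 6], [0, 0, 18, 18]), ([14, 6], [0, 0, -18, -18]), ([-16, -12], [0, 0, 12, 0]),
  ([2, 6], [0, 0, 30, 18]), ([2, 6], [0, 0, -30, -18]), ([-16, -12], [0, 0, -12, 0]),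
  ([8, 12], [0, 0, 12, 0]), ([8, 12], [0, 0, -12, 0]), ([-10, -6], [0, 0, 6, 18]),
  ([2, -6], [0, 0, 18, 18]), ([2, -6], [0, 0, -18, -18]), ([-10, -6], [0, 0, -6, -18]),
  ([20, 6], [0, 0, 18, 0]), ([20, 6], [0, 0, -18, 0]), ([-19, -3], [0, 0, 21, 9]),
  ([-1, -3], [0, 0, 39, 9]), ([-1, -3], [0, 0, -39, -9]), ([-19, -3], [0, 0, -21, -9]),
  ([8, 6], [0, 0, 6, 0]), ([8, 6], [0, 0, -6, 0]), ([-7, -3], [0, 0, 9, 9]),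
  ([-1, -3], [0, 0, 15, 9]), ([-1, -3], [0, 0, -15, -9]), ([-7, -3], [0, 0, -9, -9]),
  ([8, 0], []), ([-4, 0], [0, 0, 12, 0]), ([-4, 0], [0, 0, -12, 0]), ([5, 3], [0, 0, 3, 9]),
  ([5, 3], [0, 0, -3, -9]), ([-4, -6], [0, 0, 6, 0]), ([-1, 3], [0, 0, 9, 9]),
  ([-1, 3], [0, 0, -9, -9]), ([-4, -6], [0, 0, -6, 0]), ([17, 3], [0, 0, 15, 9]),
  ([17, 3], [0, 0, -15, -9]), ([-16, -6], [0, 0, 18, 0]), ([-1, 3], [0, 0, 33, 9]),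
  ([-1, 3], [0, 0, -33, -9]), ([-16, -6], [0, 0, -18, 0]), ([2, 6], [0, 0, 6, 18]),
  ([2, 6], [0, 0, -6, -18]), ([-4, -12], [])]

def T57 : List (ℤ × ℤ) := [
  (3380, 0), (-1690, 2927), (-1690, -2927), (3380, 1000), (3380, -1000), (-2556, 2427),
  (-824, 3427), (-824, -3427), (-2556, -2427), (2679, 1714), (2679, -1714), (-2824, 1464),
  (144, 3177), (144, -3177), (-2824, -1464), (1979, 2427), (1979, -2427), (-3091, 500),
  (1113, 2927), (1113, -2927), (-3091, -500), (2514, 500), (2514, -500), (-1690, 1927),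
  (-824, 2427), (-824, -2427), (-1690, -1927), (2412, 750), (2412, -750), (-1855, 1714),
  (-556, 2464), (-556, -2464), (-1855, -1714), (1546, 250), (1546, -250), (-989, 1214),
  (-556, 1464), (-556, -1464), (-989, -1214), (577, 0), (-289, 500), (-289, -500), (845, 964),
  (845, -964), (-1257, 250), (412, 1214), (412, -1214), (-1257, -250), (1711, 1464),
  (1711, -1464), (-2123, 750), (412, 2214), (412, -2214), (-2123, -750), (1113, 1927),
  (1113, -1927), (-2225, 0)]

def L57 : List (ℕ × ℕ) := [
  (0, 3), (0, 4), (0, 21), (0, 22), (1, 5), (1, 6), (1, 23), (1, 24), (2, 7), (2, 8), (2, 25),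
  (2, 26), (3, 9), (3, 21), (3, 27), (4, 10), (4, 22), (4, 28), (5, 11), (5, 23), (5, 29),
  (6, 12), (6, 24), (6, 30), (7, 13), (7, 25), (7, 31), (8, 14), (8, 26), (8, 32), (9, 15),
  (9, 27), (9, 48), (10, 16), (10, 28), (10, 49), (11, 17), (11, 29), (11, 50), (12, 18),
  (12, 30), (12, 51), (13, 19), (13, 31), (13, 52), (14, 20), (14, 32), (14, 53), (15, 18),
  (15, 48), (15, 54), (16, 19), (16, 49), (16, 55), (17, 20), (17, 50), (17, 56), (18, 51),
  (18, 54), (19, 52), (19, 55), (20, 53), (20, 56), (21, 22), (21, 33), (22, 34), (23, 24),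
  (23, 35), (24, 36), (25, 26), (25, 37), (26, 38), (27, 33), (27, 48), (28, 34), (28, 49),
  (29, 35), (29, 50), (30, 36), (30, 51), (31, 37), (31, 52), (32, 38), (32, 53), (33, 39),
  (33, 42), (34, 39), (34, 43), (35, 40), (35, 44), (36, 40), (36, 45), (37, 41), (37, 46),
  (38, 41), (38, 47), (39, 42), (39, 43), (40, 44), (40, 45), (41, 46), (41, 47), (42, 48),
  (42, 54), (43, 49), (43, 55), (44, 50), (44, 56), (45, 51), (45, 54), (46, 52), (46, 55),
  (47, 53), (47, 56)]

def Q57 : List Form := [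
  ([0, 0], [0, 0, 24, 0]), ([12, 0], [0, 0, 12, 0]), ([3, 3], [0, 0, 3, -9]),
  ([0, 6], [0, 0, 6, 0]), ([3, -3], [0, 0, 3, 9])]

def z57 : List ℤ := [
  72168783649, 161374306092, 41666666667, 93169499062]

def F60 : List Form := [
  ([4, 4], []), ([2, 2], [6, 2]), ([-2, -2], [6, 2]), ([-4, -4], []), ([-2, -2], [-6, -2]),
  ([2, 2], [-6, -2]), ([5, 3], [1, 1]), ([5, 3], [-1, -1]), ([1, 1], [5, 3]), ([4, 2], [4, 2]),
  ([-4, -2], [4, 2]), ([-1, -1], [5, 3]), ([-5, -3], [-1, -1]), ([-5, -3], [1, 1]),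
  ([-1, -1], [-5, -3]), ([-4, -2], [-4, -2]), ([4, 2], [-4, -2]), ([1, 1], [-5, -3]),
  ([6, 2], [2, 2]), ([6, 2], [-2, -2]), ([], [4, 4]), ([-6, -2], [2, 2]), ([-6, -2], [-2, -2]),
  ([], [-4, -4]), ([3, 3], [-1, 1]), ([3, 3], [1, -1]), ([0, 2], [4, 2]), ([3, 1], [5, 1]),
  ([-3, -1], [5, 1]), ([0, -2], [4, 2]), ([-3, -3], [1, -1]), ([-3, -3], [-1, 1]),
  ([0, -2], [-4, -2]), ([-3, -1], [-5, -1]), ([3, 1], [-5, -1]), ([0, 2], [-4, -2]),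
  ([4, 2], [0, 2]), ([4, 2], [0, -2]), ([-1, 1], [3, 3]), ([5, 1], [3, 1]), ([-5, -1], [3, 1]),
  ([1, -1], [3, 3]), ([-4, -2], [0, -2]), ([-4, -2], [0, 2]), ([1, -1], [-3, -3]),
  ([-5, -1], [-3, -1]), ([5, 1], [-3, -1]), ([-1, 1], [-3, -3]), ([3, 1], [1, 1]),
  ([3, 1], [-1, -1]), ([], [2, 2]), ([-3, -1], [1, 1]), ([-3, -1], [-1, -1]), ([], [-2, -2]),
  ([2, 2], []), ([1, 1], [3, 1]), ([-1, -1], [3, 1]), ([-2, -2], []), ([-1, -1], [-3, -1]),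
  ([1, 1], [-3, -1])]

def T60 : List (ℤ × ℤ) := [
  (3864, 0), (1932, 3346), (-1932, 3346), (-3864, 0), (-1932, -3346), (1932, -3346), (3605, 966),
  (3605, -966), (966, 3605), (2639, 2639), (-2639, 2639), (-966, 3605), (-3605, -966),
  (-3605, 966), (-966, -3605), (-2639, -2639), (2639, -2639), (966, -3605), (3346, 1932),
  (3346, -1932), (0, 3864), (-3346, 1932), (-3346, -1932), (0, -3864), (2898, 259), (2898, -259),
  (1225, 2639), (1673, 2380), (-1673, 2380), (-1225, 2639), (-2898, -259), (-2898, 259),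
  (-1225, -2639), (-1673, -2380), (1673, -2380), (1225, -2639), (2639, 1225), (2639, -1225),
  (259, 2898), (2380, 1673), (-2380, 1673), (-259, 2898), (-2639, -1225), (-2639, 1225),
  (-259, -2898), (-2380, -1673), (2380, -1673), (259, -2898), (1673, 966), (1673, -966),
  (0, 1932), (-1673, 966), (-1673, -966), (0, -1932), (1932, 0), (966, 1673), (-966, 1673),
  (-1932, 0), (-966, -1673), (966, -1673)]

def L60 : List (ℕ × ℕ) := [
  (0, 6), (0, 7), (0, 24), (0, 25), (1, 8), (1, 9), (1, 26), (1, 27), (2, 10), (2, 11), (2, 28),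
  (2, 29), (3, 12), (3, 13), (3, 30), (3, 31), (4, 14), (4, 15), (4, 32), (4, 33), (5, 16),
  (5, 17), (5, 34), (5, 35), (6, 18), (6, 24), (6, 36), (7, 19), (7, 25), (7, 37), (8, 20),
  (8, 26), (8, 38), (9, 18), (9, 27), (9, 39), (10, 21), (10, 28), (10, 40), (11, 20), (11, 29),
  (11, 41), (12, 22), (12, 30), (12, 42), (13, 21), (13, 31), (13, 43), (14, 23), (14, 32),
  (14, 44), (15, 22), (15, 33), (15, 45), (16, 19), (16, 34), (16, 46), (17, 23), (17, 35),
  (17, 47), (18, 36), (18, 39), (19, 37), (19, 46), (20, 38), (20, 41), (21, 40), (21, 43),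
  (22, 42), (22, 45), (23, 44), (23, 47), (24, 36), (24, 54), (25, 37), (25, 54), (26, 38),
  (26, 55), (27, 39), (27, 55), (28, 40), (28, 56), (29, 41), (29, 56), (30, 42), (30, 57),
  (31, 43), (31, 57), (32, 44), (32, 58), (33, 45), (33, 58), (34, 46), (34, 59), (35, 47),
  (35, 59), (36, 48), (37, 49), (38, 50), (39, 48), (40, 51), (41, 50), (42, 52), (43, 51),
  (44, 53), (45, 52), (46, 49), (47, 53), (48, 54), (48, 55), (49, 54), (49, 59), (50, 55),
  (50, 56), (51, 56), (51, 57), (52, 57), (52, 58), (53, 58), (53, 59)]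

def Q60 : List Form := [
  ([1, -1], [1, 1]), ([1, 1], [1, -1]), ([2, 0], [2, 0])]

def z60 : List ℤ := [
  353553390593, 612372435696]

def imgF (W : List Form) : List Form := W.flatMap fun f =>
  match f with
  | (x, []) => [(x, []), (negL x, [])]
  | ([], y) => [([], y), ([], negL y)]
  | (x, y) => [(x, y), (x, negL y), (negL x, negL y), (negL x, y)]

def imgT (W : List (ℤ × ℤ)) : List (ℤ × ℤ) := W.flatMap fun t =>
  if t.2 = 0 then [t, (-t.1, 0)] else if t.1 = 0 then [t, (0, -t.2)] else
    [t, (t.1, -t.2), (-t.1, -t.2), (-t.1, t.2)]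

def mkL (m : ℕ) (L : List (ℕ × ℕ)) : List (Fin (m + 1) × Fin (m + 1)) :=
  L.map fun e => (Fin.ofNat (m + 1) e.1, Fin.ofNat (m + 1) e.2)

def eqN (e f : ℕ × ℕ) : Bool := Nat.beq e.1 f.1 && Nat.beq e.2 f.2

def pairOkN (T : List (ℤ × ℤ)) (e f : ℕ × ℕ) : Bool :=
  bif Nat.beq e.1 f.1 || Nat.beq e.1 f.2 || Nat.beq e.2 f.1 || Nat.beq e.2 f.2 then !(eqN e f)
  else sep (look T e.1) (look T e.2) (look T f.1) (look T f.2)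

theorem beq_iff (a b : ℕ) : Nat.beq a b = true ↔ a = b :=
  ⟨Nat.eq_of_beq_eq_true, fun h => by rw [h]; exact Nat.beq_refl b⟩

theorem master2 (m : ℕ) (F : List Form) (T : List (ℤ × ℤ)) (z : List ℝ) (z0 : List ℤ)
    (L : List (ℕ × ℕ)) (Q : List Form)
    (hz : List.Forall₂ (fun (x : ℝ) (q : ℤ) => |10 ^ 12 * x - q| ≤ 10 ^ 6) z z0)
    (hQ : ∀ q ∈ Q, dotR q.1 z ^ 2 + dotR q.2 z ^ 2 = 1)
    (c1 : allN (m + 1) (fun i => closeB (lookF F i).1 z0 (look T i).1 &&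
      closeB (lookF F i).2 z0 (look T i).2) = true)
    (c2 : allN (m + 1) (fun i => allN i fun j => farB (look T i) (look T j)) = true)
    (c3 : pw (pairOkN T) L = true)
    (c4 : L.all (fun e => Nat.blt e.1 e.2 && Nat.blt e.2 (m + 1) &&
      Q.any (fun q => matchE (lookF F e.1) (lookF F e.2) q)) = true)
    (c5 : Nat.beq L.length (2 * (m + 1)) = true)
    (c6 : allN (m + 1) (fun v =>
      Nat.beq (L.filter (fun e => Nat.beq e.1 v || Nat.beq e.2 v)).length 4) = true) :
    ∃ (P : Fin (m + 1) → EuclideanSpace ℝ (Fin 2)) (E : Finset (Fin (m + 1) × Fin (m + 1))),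
      Function.Injective P ∧ (∀ e ∈ E, e.1 < e.2) ∧ E.card = 2 * (m + 1) ∧
      (∀ v : Fin (m + 1), (E.filter (fun e => e.1 = v ∨ e.2 = v)).card = 4) ∧
      (∀ e ∈ E, ∀ f ∈ E, e ≠ f → ∀ x ∈ segment ℝ (P e.1) (P e.2) ∩ segment ℝ (P f.1) (P f.2),
          (x = P e.1 ∨ x = P e.2) ∧ (x = P f.1 ∨ x = P f.2)) ∧
      (∀ e ∈ E, dist (P e.1) (P e.2) = 1) := by
  rw [List.all_eq_true] at c4
  have hv : ∀ a : ℕ, a < m + 1 → ((Fin.ofNat (m + 1) a : Fin (m + 1)) : ℕ) = a :=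
    fun a ha => Nat.mod_eq_of_lt ha
  have hlt : ∀ e ∈ L, e.1 < e.2 ∧ e.2 < m + 1 ∧
      Q.any (fun q => matchE (lookF F e.1) (lookF F e.2) q) = true := by
    intro e he
    have h := c4 e he
    rw [Bool.and_eq_true, Bool.and_eq_true] at h
    exact ⟨Nat.le_of_ble_eq_true h.1.1, Nat.le_of_ble_eq_true h.1.2, h.2⟩
  have h1 : ∀ e ∈ L, ((Fin.ofNat (m + 1) e.1 : Fin (m + 1)) : ℕ) = e.1 :=
    fun e he => hv _ ((hlt e he).1.trans (hlt e he).2.1)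
  have h2 : ∀ e ∈ L, ((Fin.ofNat (m + 1) e.2 : Fin (m + 1)) : ℕ) = e.2 :=
    fun e he => hv _ (hlt e he).2.1
  refine master (m + 1) F T z z0 (mkL m L) Q hz hQ c1 c2 ?_ ?_ ?_ ?_
  · rw [mkL, List.pairwise_map]
    refine (pw_sound _ _ c3).imp_of_mem ?_
    intro e f he hf h
    simp only [pairOk, Bool.and_eq_true, Bool.or_eq_true, decide_eq_true_eq, ne_eq, Prod.ext_iff,
      Fin.ext_iff, h1 e he, h2 e he, h1 f hf, h2 f hf]
    simp only [pairOkN, eqN] at h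
    cases hb : (Nat.beq e.1 f.1 || Nat.beq e.1 f.2 || Nat.beq e.2 f.1 || Nat.beq e.2 f.2) with
    | true =>
      rw [hb, cond_true, Bool.not_eq_true', Bool.eq_false_iff, ne_eq, Bool.and_eq_true, beq_iff,
        beq_iff] at h
      simp only [Bool.or_eq_true, beq_iff] at hb
      exact ⟨h, Or.inl hb⟩
    | false =>
      rw [hb, cond_false] at h
      rw [Bool.eq_false_iff] at hb
      simp only [ne_eq, Bool.or_eq_true, beq_iff, not_or] at hb
      exact ⟨fun hh => hb.1.1.1 hh.1, Or.inr h⟩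
  · intro e' he'
    rw [mkL, List.mem_map] at he'
    obtain ⟨e, he, rfl⟩ := he'
    refine ⟨?_, ?_⟩
    · rw [Fin.lt_def]
      simp only [h1 e he, h2 e he]
      exact (hlt e he).1
    · simp only [h1 e he, h2 e he]
      exact (hlt e he).2.2
  · rw [mkL, List.length_map]; exact Nat.eq_of_beq_eq_true c5
  · intro v
    have h := Nat.eq_of_beq_eq_true (allN_sound _ _ c6 v v.2)
    rw [mkL, List.filter_map, List.length_map, ← h]
    congr 1
    apply List.filter_congr
    intro e he
    rw [Bool.eq_iff_iff]
    simp only [Function.comp, decide_eq_true_eq, Bool.or_eq_true, beq_iff, Fin.ext_iff, h1 e he,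
      h2 e he]

theorem sol52 : ∃ z : List ℝ,
    List.Forall₂ (fun (x : ℝ) (q : ℤ) => |10 ^ 12 * x - q| ≤ 10 ^ 6) z z52 ∧
      ∀ q ∈ Q52, dotR q.1 z ^ 2 + dotR q.2 z ^ 2 = 1 :=
  nkL 11 Q52 A52 XA52 YA52 xz52 yz52 z52 (by decide +kernel) (by decide +kernel)

theorem sol54 : ∃ z : List ℝ,
    List.Forall₂ (fun (x : ℝ) (q : ℤ) => |10 ^ 12 * x - q| ≤ 10 ^ 6) z z54 ∧
      ∀ q ∈ Q54, dotR q.1 z ^ 2 + dotR q.2 z ^ 2 = 1 :=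
  nkL 9 Q54 A54 XA54 YA54 xz54 yz54 z54 (by decide +kernel) (by decide +kernel)

theorem sol60 : ∃ z : List ℝ,
    List.Forall₂ (fun (x : ℝ) (q : ℤ) => |10 ^ 12 * x - q| ≤ 10 ^ 6) z z60 ∧
      ∀ q ∈ Q60, dotR q.1 z ^ 2 + dotR q.2 z ^ 2 = 1 := by
  have h2 := Real.sq_sqrt (show (0:ℝ) ≤ 2 by norm_num)
  have h6 := Real.sq_sqrt (show (0:ℝ) ≤ 6 by norm_num)
  have a2 : |√2 - 1.414213562373| ≤ 1 / 10 ^ 10 := by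
    rw [abs_le]; constructor
    · have : (1.4142135623:ℝ) ≤ √2 := Real.le_sqrt_of_sq_le (by norm_num)
      linarith
    · have : √2 ≤ (1.4142135624:ℝ) := Real.sqrt_le_iff.2 (by norm_num)
      linarith
  have a6 : |√6 - 2.449489742783| ≤ 1 / 10 ^ 10 := by
    rw [abs_le]; constructor
    · have : (2.4494897427:ℝ) ≤ √6 := Real.le_sqrt_of_sq_le (by norm_num)
      linarith
    · have : √6 ≤ (2.4494897428:ℝ) := Real.sqrt_le_iff.2 (by norm_num)
      linarith
  rw [abs_le] at a2 a6
  refine ⟨[√2 / 4, √6 / 4], ?_, ?_⟩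
  · simp only [z60, List.forall₂_cons, List.forall₂_nil_left_iff, and_true]
    refine ⟨?_, ?_⟩ <;> (rw [abs_le]; push_cast; constructor <;> linarith)
  · intro q hq
    simp only [Q60, List.mem_cons, List.not_mem_nil, or_false] at hq
    rcases hq with rfl | rfl | rfl <;> simp only [dotR] <;> push_cast <;> nlinarith

theorem sol57 : ∃ z : List ℝ,
    List.Forall₂ (fun (x : ℝ) (q : ℤ) => |10 ^ 12 * x - q| ≤ 10 ^ 6) z z57 ∧
      ∀ q ∈ Q57, dotR q.1 z ^ 2 + dotR q.2 z ^ 2 = 1 := by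
  have h3 := Real.sq_sqrt (show (0:ℝ) ≤ 3 by norm_num)
  have h5 := Real.sq_sqrt (show (0:ℝ) ≤ 5 by norm_num)
  have h15 : √15 = √3 * √5 := by rw [← Real.sqrt_mul (by norm_num)]; norm_num
  have a3 : |√3 - 1.73205080757| ≤ 1 / 10 ^ 10 := by
    rw [abs_le]; constructor
    · have : (1.7320508075:ℝ) ≤ √3 := Real.le_sqrt_of_sq_le (by norm_num)
      linarith
    · have : √3 ≤ (1.7320508076:ℝ) := Real.sqrt_le_iff.2 (by norm_num)
      linarith
  have a5 : |√5 - 2.2360679775| ≤ 1 / 10 ^ 10 := by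
    rw [abs_le]; constructor
    · have : (2.2360679774:ℝ) ≤ √5 := Real.le_sqrt_of_sq_le (by norm_num)
      linarith
    · have : √5 ≤ (2.2360679775:ℝ) := Real.sqrt_le_iff.2 (by norm_num)
      linarith
  have a15 : |√15 - 3.8729833462| ≤ 1 / 10 ^ 10 := by
    rw [abs_le]; constructor
    · have : (3.8729833462:ℝ) ≤ √15 := Real.le_sqrt_of_sq_le (by norm_num)
      linarith
    · have : √15 ≤ (3.8729833463:ℝ) := Real.sqrt_le_iff.2 (by norm_num)
      linarith
  rw [abs_le] at a3 a5 a15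
  refine ⟨[√3 / 24, √15 / 24, 1 / 24, √5 / 24], ?_, ?_⟩
  · simp only [z57, List.forall₂_cons, List.forall₂_nil_left_iff, and_true]
    refine ⟨?_, ?_, ?_, ?_⟩ <;> (rw [abs_le]; push_cast; constructor <;> linarith)
  · intro q hq
    have e : √15 ^ 2 = 15 := Real.sq_sqrt (by norm_num)
    have e2 : √3 * √15 = 3 * √5 := by rw [h15, ← mul_assoc, ← sq, h3]
    simp only [Q57, List.mem_cons, List.not_mem_nil, or_false] at hq
    rcases hq with rfl | rfl | rfl | rfl | rfl <;> simp only [dotR] <;> push_cast <;> nlinarith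

theorem graph52 : ∃ (P : Fin 52 → EuclideanSpace ℝ (Fin 2)) (E : Finset (Fin 52 × Fin 52)),
      Function.Injective P ∧ (∀ e ∈ E, e.1 < e.2) ∧ E.card = 2 * 52 ∧
      (∀ v : Fin 52, (E.filter (fun e => e.1 = v ∨ e.2 = v)).card = 4) ∧
      (∀ e ∈ E, ∀ f ∈ E, e ≠ f → ∀ x ∈ segment ℝ (P e.1) (P e.2) ∩ segment ℝ (P f.1) (P f.2),
          (x = P e.1 ∨ x = P e.2) ∧ (x = P f.1 ∨ x = P f.2)) ∧
      (∀ e ∈ E, dist (P e.1) (P e.2) = 1) := by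
  obtain ⟨z, hz, hQ⟩ := sol52
  exact master2 51 (imgF W52) (imgT T52) z z52 L52 Q52 hz hQ (by decide +kernel)
    (by decide +kernel) (by decide +kernel) (by decide +kernel) (by decide +kernel)
    (by decide +kernel)

theorem graph54 : ∃ (P : Fin 54 → EuclideanSpace ℝ (Fin 2)) (E : Finset (Fin 54 × Fin 54)),
      Function.Injective P ∧ (∀ e ∈ E, e.1 < e.2) ∧ E.card = 2 * 54 ∧
      (∀ v : Fin 54, (E.filter (fun e => e.1 = v ∨ e.2 = v)).card = 4) ∧
      (∀ e ∈ E, ∀ f ∈ E, e ≠ f → ∀ x ∈ segment ℝ (P e.1) (P e.2) ∩ segment ℝ (P f.1) (P f.2),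
          (x = P e.1 ∨ x = P e.2) ∧ (x = P f.1 ∨ x = P f.2)) ∧
      (∀ e ∈ E, dist (P e.1) (P e.2) = 1) := by
  obtain ⟨z, hz, hQ⟩ := sol54
  exact master2 53 (imgF W54) (imgT T54) z z54 L54 Q54 hz hQ (by decide +kernel)
    (by decide +kernel) (by decide +kernel) (by decide +kernel) (by decide +kernel)
    (by decide +kernel)

theorem graph57 : ∃ (P : Fin 57 → EuclideanSpace ℝ (Fin 2)) (E : Finset (Fin 57 × Fin 57)),
      Function.Injective P ∧ (∀ e ∈ E, e.1 < e.2) ∧ E.card = 2 * 57 ∧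
      (∀ v : Fin 57, (E.filter (fun e => e.1 = v ∨ e.2 = v)).card = 4) ∧
      (∀ e ∈ E, ∀ f ∈ E, e ≠ f → ∀ x ∈ segment ℝ (P e.1) (P e.2) ∩ segment ℝ (P f.1) (P f.2),
          (x = P e.1 ∨ x = P e.2) ∧ (x = P f.1 ∨ x = P f.2)) ∧
      (∀ e ∈ E, dist (P e.1) (P e.2) = 1) := by
  obtain ⟨z, hz, hQ⟩ := sol57
  exact master2 56 F57 T57 z z57 L57 Q57 hz hQ (by decide +kernel)
    (by decide +kernel) (by decide +kernel) (by decide +kernel) (by decide +kernel)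
    (by decide +kernel)

theorem graph60 : ∃ (P : Fin 60 → EuclideanSpace ℝ (Fin 2)) (E : Finset (Fin 60 × Fin 60)),
      Function.Injective P ∧ (∀ e ∈ E, e.1 < e.2) ∧ E.card = 2 * 60 ∧
      (∀ v : Fin 60, (E.filter (fun e => e.1 = v ∨ e.2 = v)).card = 4) ∧
      (∀ e ∈ E, ∀ f ∈ E, e ≠ f → ∀ x ∈ segment ℝ (P e.1) (P e.2) ∩ segment ℝ (P f.1) (P f.2),
          (x = P e.1 ∨ x = P e.2) ∧ (x = P f.1 ∨ x = P f.2)) ∧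
      (∀ e ∈ E, dist (P e.1) (P e.2) = 1) := by
  obtain ⟨z, hz, hQ⟩ := sol60
  exact master2 59 F60 T60 z z60 L60 Q60 hz hQ (by decide +kernel)
    (by decide +kernel) (by decide +kernel) (by decide +kernel) (by decide +kernel)
    (by decide +kernel)

theorem graph64 : ∃ (P : Fin 64 → EuclideanSpace ℝ (Fin 2)) (E : Finset (Fin 64 × Fin 64)),
      Function.Injective P ∧ (∀ e ∈ E, e.1 < e.2) ∧ E.card = 2 * 64 ∧
      (∀ v : Fin 64, (E.filter (fun e => e.1 = v ∨ e.2 = v)).card = 4) ∧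
      (∀ e ∈ E, ∀ f ∈ E, e ≠ f → ∀ x ∈ segment ℝ (P e.1) (P e.2) ∩ segment ℝ (P f.1) (P f.2),
          (x = P e.1 ∨ x = P e.2) ∧ (x = P f.1 ∨ x = P f.2)) ∧
      (∀ e ∈ E, dist (P e.1) (P e.2) = 1) := by
  obtain ⟨z, hz, hQ⟩ := sol52
  exact master2 63 (imgF W64) (imgT T64) z z52 L64 Q52 hz hQ (by decide +kernel)
    (by decide +kernel) (by decide +kernel) (by decide +kernel) (by decide +kernel)
    (by decide +kernel)

end Matchstick

theorem four_regular_matchstick_graph_exists_of_mem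
    (n : ℕ) (hn : n ∈ ({52, 54, 57, 60, 64} : Finset ℕ)) :
    ∃ (P : Fin n → EuclideanSpace ℝ (Fin 2)) (E : Finset (Fin n × Fin n)),
      Function.Injective P ∧
      (∀ e ∈ E, e.1 < e.2) ∧
      E.card = 2 * n ∧
      (∀ v : Fin n, (E.filter (fun e => e.1 = v ∨ e.2 = v)).card = 4) ∧
      (∀ e ∈ E, ∀ f ∈ E, e ≠ f →
        ∀ x ∈ segment ℝ (P e.1) (P e.2) ∩ segment ℝ (P f.1) (P f.2),
          (x = P e.1 ∨ x = P e.2) ∧ (x = P f.1 ∨ x = P f.2)) ∧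
      (∀ e ∈ E, dist (P e.1) (P e.2) = 1) := by
  simp only [Finset.mem_insert, Finset.mem_singleton] at hn
  rcases hn with rfl | rfl | rfl | rfl | rfl
  · exact Matchstick.graph52
  · exact Matchstick.graph54
  · exact Matchstick.graph57
  · exact Matchstick.graph60
  · exact Matchstick.graph64
end

section
/- For every ε > 0 there exist 27 distinct points in ℝ² and a set E of 54 unordered pairs of these points such that every point is an endpoint of exactly 4 pairs in E, the closed segments of any two distinct pairs intersect at most in a common endpoint, exactly 48 of the pairs join points at distance exactly 1, and the remaining 6 pairs all join points at one common distance t satisfying 1 < t < 1 + ε. -/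
namespace EpsGraph

/-! Polynomials in one variable `q` with integer coefficients, as coefficient lists (lowest first). -/

noncomputable def ev : List ℤ → ℝ → ℝ
  | [], _ => 0
  | a :: p, q => (a : ℝ) + q * ev p q

def padd : List ℤ → List ℤ → List ℤ
  | [], p => p
  | a :: p, [] => a :: p
  | a :: p, b :: r => (a + b) :: padd p r

def pneg : List ℤ → List ℤ
  | [] => []
  | a :: p => (-a) :: pneg p

def pscale (c : ℤ) : List ℤ → List ℤ
  | [] => []
  | a :: p => (c * a) :: pscale c p

def pmul : List ℤ → List ℤ → List ℤ
  | [], _ => []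
  | a :: p, r => padd (pscale a r) (0 :: pmul p r)

def psub (p r : List ℤ) : List ℤ := padd p (pneg r)

/-- The lowest nonzero coefficient is positive. -/
def posLead : List ℤ → Bool
  | [] => false
  | Int.ofNat 0 :: p => posLead p
  | Int.ofNat (_ + 1) :: _ => true
  | Int.negSucc _ :: _ => false

def isZero : List ℤ → Bool
  | [] => true
  | Int.ofNat 0 :: p => isZero p
  | Int.ofNat (_ + 1) :: _ => false
  | Int.negSucc _ :: _ => false

theorem ev_padd (p r : List ℤ) (q : ℝ) : ev (padd p r) q = ev p q + ev r q := by
  induction p generalizing r with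
  | nil => simp [padd, ev]
  | cons a p ih =>
    cases r with
    | nil => simp [padd, ev]
    | cons b r => simp only [padd, ev, ih]; push_cast; ring

theorem ev_pneg (p : List ℤ) (q : ℝ) : ev (pneg p) q = - ev p q := by
  induction p with
  | nil => simp [pneg, ev]
  | cons a p ih => simp only [pneg, ev, ih]; push_cast; ring

theorem ev_pscale (c : ℤ) (p : List ℤ) (q : ℝ) : ev (pscale c p) q = c * ev p q := by
  induction p with
  | nil => simp [pscale, ev]
  | cons a p ih => simp only [pscale, ev, ih]; push_cast; ring

theorem ev_pmul (p r : List ℤ) (q : ℝ) : ev (pmul p r) q = ev p q * ev r q := by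
  induction p with
  | nil => simp [pmul, ev]
  | cons a p ih => simp only [pmul, ev, ih, ev_padd, ev_pscale]; push_cast; ring

theorem ev_psub (p r : List ℤ) (q : ℝ) : ev (psub p r) q = ev p q - ev r q := by
  rw [psub, ev_padd, ev_pneg]; ring

theorem ev_continuous (p : List ℤ) : Continuous (ev p) := by
  induction p with
  | nil => exact continuous_const
  | cons a p ih => exact continuous_const.add (continuous_id.mul ih)

theorem ev_isZero (p : List ℤ) (h : isZero p = true) (q : ℝ) : ev p q = 0 := by
  induction p with
  | nil => rfl
  | cons a p ih =>
    match a, h with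
    | Int.ofNat 0, h =>
      have : isZero p = true := h
      simp [ev, ih this]

open Filter Topology in
theorem ev_pos (p : List ℤ) (h : posLead p = true) : ∀ᶠ q in 𝓝[>] (0 : ℝ), 0 < ev p q := by
  induction p with
  | nil => exact absurd h (by simp [posLead])
  | cons a p ih =>
    match a, h with
    | Int.ofNat 0, h =>
      have h' : posLead p = true := h
      filter_upwards [ih h', self_mem_nhdsWithin] with q hq hq0
      have : (0 : ℝ) < q := hq0
      have := mul_pos this hq
      simpa [ev] using this
    | Int.ofNat (n + 1), h =>
      have hc := (ev_continuous (Int.ofNat (n + 1) :: p)).tendsto 0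
      have h0 : (0 : ℝ) < ev (Int.ofNat (n + 1) :: p) 0 := by
        simp only [ev, zero_mul, add_zero]
        have : (0 : ℤ) < Int.ofNat (n + 1) := by simp
        exact_mod_cast this
      exact (hc.eventually (lt_mem_nhds h0)).filter_mono nhdsWithin_le_nhds

/-! The points, in coordinates with respect to the basis `1, exp(iπ/3)`, scaled by `1+q+q²`. -/

def pts : List (List ℤ × List ℤ) :=
  [([0, 0, 0], [0, 0, 0]),
   ([1, 1, 1], [0, 0, 0]),
   ([2, 2, 2], [0, 0, 0]),
   ([0, 0, 0], [1, 1, 1]),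
   ([1, 1, 1], [1, 1, 1]),
   ([1, 2, 3], [1, 2, 0]),
   ([0, 1, 2], [2, 3, 1]),
   ([2, 3, 4], [1, 2, 0]),
   ([1, 2, 3], [2, 3, 1]),
   ([2, 2, 2], [2, 5, 2]),
   ([1, 1, 1], [3, 6, 3]),
   ([0, 0, 0], [4, 7, 4]),
   ([1, 1, 1], [2, 5, 2]),
   ([0, 0, 0], [3, 6, 3]),
   ([0, -2, -1], [3, 7, 5]),
   ([0, -2, -1], [2, 6, 4]),
   ([-1, -3, -2], [4, 8, 6]),
   ([-1, -3, -2], [3, 7, 5]),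
   ([-2, -5, -2], [4, 7, 4]),
   ([-2, -5, -2], [3, 6, 3]),
   ([-2, -5, -2], [2, 5, 2]),
   ([-1, -4, -1], [3, 6, 3]),
   ([-1, -4, -1], [2, 5, 2]),
   ([-1, -3, -2], [2, 3, 1]),
   ([0, -2, -1], [2, 3, 1]),
   ([-1, -3, -2], [1, 2, 0]),
   ([0, -2, -1], [1, 2, 0])]

def El : List (Fin 27 × Fin 27) :=
  [(0, 1), (0, 3), (0, 25), (0, 26), (1, 2), (1, 3), (1, 4), (2, 4), (2, 5), (2, 7), (3, 4),
   (3, 24), (4, 6), (5, 6), (5, 7), (5, 8), (6, 8), (6, 12), (7, 8), (7, 9), (8, 9), (9, 10),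
   (9, 12), (10, 11), (10, 12), (10, 13), (11, 13), (11, 14), (11, 16), (12, 13), (13, 15),
   (14, 15), (14, 16), (14, 17), (15, 17), (15, 21), (16, 17), (16, 18), (17, 18), (18, 19),
   (18, 21), (19, 20), (19, 21), (19, 22), (20, 22), (20, 23), (20, 25), (21, 22), (22, 24),
   (23, 24), (23, 25), (23, 26), (24, 26), (25, 26)]

def E : Finset (Fin 27 × Fin 27) := El.toFinset

def pt (i : Fin 27) : List ℤ × List ℤ := pts.getD i.val ([], [])

def phi (φ : List ℤ × List ℤ) (i : Fin 27) : List ℤ :=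
  padd (pmul φ.1 (pt i).1) (pmul φ.2 (pt i).2)

def gtL (φ : List ℤ × List ℤ) (i j : Fin 27) : Bool := posLead (psub (phi φ i) (phi φ j))

def geL (φ : List ℤ × List ℤ) (i j : Fin 27) : Bool :=
  gtL φ i j || isZero (psub (phi φ i) (phi φ j))

def sepS (φ : List ℤ × List ℤ) (a b c : Fin 27) : Bool := gtL φ b a && geL φ a c

def sepD (φ : List ℤ × List ℤ) (a b c d : Fin 27) : Bool :=
  gtL φ a c && gtL φ a d && gtL φ b c && gtL φ b d

def nrm (a b : Fin 27) : List ℤ × List ℤ :=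
  (psub (pt b).2 (pt a).2, psub (pt a).1 (pt b).1)

def ngv (φ : List ℤ × List ℤ) : List ℤ × List ℤ := (pneg φ.1, pneg φ.2)

def cands (e f : Fin 27 × Fin 27) : List (List ℤ × List ℤ) :=
  [([1], []), ([-1], []), ([], [1]), ([], [-1]), ([1], [1]), ([-1], [-1]),
    nrm e.1 e.2, ngv (nrm e.1 e.2), nrm f.1 f.2, ngv (nrm f.1 f.2)]

def chkφ (e f : Fin 27 × Fin 27) (φ : List ℤ × List ℤ) : Bool :=
  (decide (e.1 = f.1) && sepS φ e.1 e.2 f.2) || (decide (e.1 = f.2) && sepS φ e.1 e.2 f.1) ||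
  (decide (e.2 = f.1) && sepS φ e.2 e.1 f.2) || (decide (e.2 = f.2) && sepS φ e.2 e.1 f.1) ||
  sepD φ e.1 e.2 f.1 f.2

def chk (e f : Fin 27 × Fin 27) : Bool := (cands e f).any (chkφ e f)

def nf (i j : Fin 27) : List ℤ :=
  let X := psub (pt i).1 (pt j).1
  let Y := psub (pt i).2 (pt j).2
  padd (padd (pmul X X) (pmul X Y)) (pmul Y Y)

def isU (e : Fin 27 × Fin 27) : Bool := decide (nf e.1 e.2 = [1, 2, 3, 2, 1])

def chkAll : List (Fin 27 × Fin 27) → Bool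
  | [] => true
  | e :: l => l.all (chk e) && chkAll l

theorem chkAll_pairwise (l : List (Fin 27 × Fin 27)) (h : chkAll l = true) :
    l.Pairwise (fun e f => chk e f = true) := by
  induction l with
  | nil => exact List.Pairwise.nil
  | cons e l ih =>
    rw [chkAll, Bool.and_eq_true, List.all_eq_true] at h
    exact List.Pairwise.cons h.1 (ih h.2)

theorem chkAll_El : chkAll El = true := by decide +kernel

theorem chk_all (e : Fin 27 × Fin 27) (he : e ∈ El) (f : Fin 27 × Fin 27) (hf : f ∈ El)
    (hef : e ≠ f) : chk e f = true ∨ chk f e = true := by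
  have key : ∀ l : List (Fin 27 × Fin 27), l.Pairwise (fun e f => chk e f = true) →
      e ∈ l → f ∈ l → chk e f = true ∨ chk f e = true := by
    intro l hl
    induction hl with
    | nil => intro h; cases h
    | cons h _ ih =>
      intro h1 h2
      rcases List.mem_cons.1 h1 with h1 | h1 <;> rcases List.mem_cons.1 h2 with h2 | h2
      · exact absurd (h1.trans h2.symm) hef
      · exact Or.inl (h1 ▸ h _ h2)
      · exact Or.inr (h2 ▸ h _ h1)
      · exact ih h1 h2
  exact key El (chkAll_pairwise El chkAll_El) he hf

theorem inj_all : ∀ i j : Fin 27, i ≠ j → posLead (nf i j) = true := by decide +kernel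

theorem E_lt : ∀ e ∈ E, e.1 < e.2 := by decide +kernel

theorem E_card : E.card = 54 := by decide +kernel

theorem E_deg : ∀ v : Fin 27, (E.filter (fun e => e.1 = v ∨ e.2 = v)).card = 4 := by
  decide +kernel

theorem E_unit : (E.filter (fun e => isU e = true)).card = 48 := by decide +kernel

theorem E_len : ∀ e ∈ El, isU e = true ∨ nf e.1 e.2 = [1, 5, 9, 8, 4] := by decide +kernel

/-! Geometry. -/

noncomputable def P (q : ℝ) (i : Fin 27) : EuclideanSpace ℝ (Fin 2) :=
  !₂[(ev (pt i).1 q + ev (pt i).2 q / 2) / (1 + q + q ^ 2),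
    (√3 / 2 * ev (pt i).2 q) / (1 + q + q ^ 2)]

theorem N_pos (q : ℝ) : 0 < 1 + q + q ^ 2 := by nlinarith [sq_nonneg (q + 1 / 2)]

theorem dist_P (q : ℝ) (i j : Fin 27) :
    dist (P q i) (P q j) = √(ev (nf i j) q) / (1 + q + q ^ 2) := by
  have hN := N_pos q
  have h3 : √(3 : ℝ) ^ 2 = 3 := Real.sq_sqrt (by norm_num)
  rw [EuclideanSpace.dist_eq, Fin.sum_univ_two]
  have : √(ev (nf i j) q) / (1 + q + q ^ 2) = √(ev (nf i j) q / (1 + q + q ^ 2) ^ 2) := by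
    rw [Real.sqrt_div' _ (by positivity), Real.sqrt_sq hN.le]
  rw [this]
  congr 1
  simp only [Real.dist_eq, sq_abs, P, nf, ev_padd, ev_pmul, ev_psub]
  simp only [Matrix.cons_val_zero, Matrix.cons_val_one]
  rw [← sub_div, ← sub_div, div_pow, div_pow, ← add_div]
  congr 1
  have : ∀ a b : ℝ, (√3 / 2 * a - √3 / 2 * b) ^ 2 = 3 / 4 * (a - b) ^ 2 := by
    intro a b
    have : (√3 / 2 * a - √3 / 2 * b) ^ 2 = √3 ^ 2 / 4 * (a - b) ^ 2 := by ring
    rw [this, h3]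
  rw [this]
  ring

theorem exists_lin (q α β : ℝ) : ∃ L : EuclideanSpace ℝ (Fin 2) →ₗ[ℝ] ℝ,
    ∀ i, L (P q i) = α * ev (pt i).1 q + β * ev (pt i).2 q := by
  have hN := N_pos q
  have h3 : √(3 : ℝ) ≠ 0 := by positivity
  refine ⟨(α * (1 + q + q ^ 2)) • (EuclideanSpace.proj (𝕜 := ℝ) (0 : Fin 2)).toLinearMap +
    ((β * 2 - α) / √3 * (1 + q + q ^ 2)) •
      (EuclideanSpace.proj (𝕜 := ℝ) (1 : Fin 2)).toLinearMap, fun i => ?_⟩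
  simp [P]
  field_simp
  ring

theorem seg_disj {V : Type*} [AddCommGroup V] [Module ℝ V] (L : V →ₗ[ℝ] ℝ) (a b c d x : V)
    (h1 : L c < L a) (h2 : L d < L a) (h3 : L c < L b) (h4 : L d < L b)
    (hx : x ∈ segment ℝ a b) (hy : x ∈ segment ℝ c d) : False := by
  obtain ⟨s, t, hs, ht, hst, rfl⟩ := hx
  obtain ⟨s', t', hs', ht', hst', h⟩ := hy
  have := congrArg L h
  simp only [map_add, map_smul, smul_eq_mul] at this
  have A : min (L a) (L b) ≤ s * L a + t * L b := by
    have e1 := mul_le_mul_of_nonneg_left (min_le_left (L a) (L b)) hs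
    have e2 := mul_le_mul_of_nonneg_left (min_le_right (L a) (L b)) ht
    have : min (L a) (L b) = s * min (L a) (L b) + t * min (L a) (L b) := by
      rw [← add_mul, hst, one_mul]
    linarith
  have B : s' * L c + t' * L d ≤ max (L c) (L d) := by
    have e1 := mul_le_mul_of_nonneg_left (le_max_left (L c) (L d)) hs'
    have e2 := mul_le_mul_of_nonneg_left (le_max_right (L c) (L d)) ht'
    have : max (L c) (L d) = s' * max (L c) (L d) + t' * max (L c) (L d) := by
      rw [← add_mul, hst', one_mul]
    linarith
  have C : max (L c) (L d) < min (L a) (L b) := by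
    rw [max_lt_iff, lt_min_iff, lt_min_iff]; exact ⟨⟨h1, h3⟩, ⟨h2, h4⟩⟩
  linarith

theorem seg_share {V : Type*} [AddCommGroup V] [Module ℝ V] (L : V →ₗ[ℝ] ℝ) (a b c x : V)
    (h1 : L a < L b) (h2 : L c ≤ L a)
    (hx : x ∈ segment ℝ a b) (hy : x ∈ segment ℝ a c) : x = a := by
  obtain ⟨s, t, hs, ht, hst, rfl⟩ := hx
  obtain ⟨s', t', hs', ht', hst', h⟩ := hy
  have := congrArg L h
  simp only [map_add, map_smul, smul_eq_mul] at this
  have e1 := mul_le_mul_of_nonneg_left h2 ht'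
  have e2 : s' * L a + t' * L a = L a := by rw [← add_mul, hst', one_mul]
  have e3 : s * L a + t * L a = L a := by rw [← add_mul, hst, one_mul]
  have e4 : t * (L b - L a) ≤ 0 := by linarith
  have e5 : t = 0 := by
    by_contra hne
    have : 0 < t := lt_of_le_of_ne ht (Ne.symm hne)
    have := mul_pos this (sub_pos.2 h1)
    linarith
  have e6 : s = 1 := by linarith
  simp [e5, e6]

def Good (q : ℝ) (e f : Fin 27 × Fin 27) : Prop :=
  ∀ x ∈ segment ℝ (P q e.1) (P q e.2) ∩ segment ℝ (P q f.1) (P q f.2),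
    (x = P q e.1 ∨ x = P q e.2) ∧ (x = P q f.1 ∨ x = P q f.2)

open Filter Topology

theorem gtL_ev (φ : List ℤ × List ℤ) (i j : Fin 27) (h : gtL φ i j = true) :
    ∀ᶠ q in 𝓝[>] (0 : ℝ), ev (phi φ j) q < ev (phi φ i) q := by
  filter_upwards [ev_pos _ h] with q hq
  rw [ev_psub] at hq
  linarith

theorem geL_ev (φ : List ℤ × List ℤ) (i j : Fin 27) (h : geL φ i j = true) :
    ∀ᶠ q in 𝓝[>] (0 : ℝ), ev (phi φ j) q ≤ ev (phi φ i) q := by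
  rw [geL, Bool.or_eq_true] at h
  rcases h with h | h
  · filter_upwards [gtL_ev φ i j h] with q hq using hq.le
  · refine Eventually.of_forall fun q => ?_
    have := ev_isZero _ h q
    rw [ev_psub] at this
    linarith

theorem lin_phi (q : ℝ) (φ : List ℤ × List ℤ) : ∃ L : EuclideanSpace ℝ (Fin 2) →ₗ[ℝ] ℝ,
    ∀ i, L (P q i) = ev (phi φ i) q := by
  obtain ⟨L, hL⟩ := exists_lin q (ev φ.1 q) (ev φ.2 q)
  exact ⟨L, fun i => by rw [hL, phi, ev_padd, ev_pmul, ev_pmul]⟩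

theorem sepS_ev (φ : List ℤ × List ℤ) (a b c : Fin 27) (h : sepS φ a b c = true) :
    ∀ᶠ q in 𝓝[>] (0 : ℝ), ∀ x ∈ segment ℝ (P q a) (P q b), x ∈ segment ℝ (P q a) (P q c) →
      x = P q a := by
  rw [sepS, Bool.and_eq_true] at h
  filter_upwards [gtL_ev _ _ _ h.1, geL_ev _ _ _ h.2] with q h1 h2 x hx hy
  obtain ⟨L, hL⟩ := lin_phi q φ
  exact seg_share L _ _ _ x (by rw [hL, hL]; exact h1) (by rw [hL, hL]; exact h2) hx hy

theorem sepD_ev (φ : List ℤ × List ℤ) (a b c d : Fin 27) (h : sepD φ a b c d = true) :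
    ∀ᶠ q in 𝓝[>] (0 : ℝ), ∀ x ∈ segment ℝ (P q a) (P q b), x ∈ segment ℝ (P q c) (P q d) →
      False := by
  simp only [sepD, Bool.and_eq_true] at h
  obtain ⟨⟨⟨h1, h2⟩, h3⟩, h4⟩ := h
  filter_upwards [gtL_ev _ _ _ h1, gtL_ev _ _ _ h2, gtL_ev _ _ _ h3, gtL_ev _ _ _ h4]
    with q h1 h2 h3 h4 x hx hy
  obtain ⟨L, hL⟩ := lin_phi q φ
  refine seg_disj L _ _ _ _ x ?_ ?_ ?_ ?_ hx hy <;> rw [hL, hL] <;> assumption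

theorem chk_good (e f : Fin 27 × Fin 27) (h : chk e f = true) :
    ∀ᶠ q in 𝓝[>] (0 : ℝ), Good q e f := by
  rw [chk, List.any_eq_true] at h
  obtain ⟨φ, -, h⟩ := h
  simp only [chkφ, Bool.or_eq_true, Bool.and_eq_true, decide_eq_true_eq] at h
  obtain ⟨e1, e2⟩ := e
  obtain ⟨f1, f2⟩ := f
  rcases h with (((⟨h0, h⟩ | ⟨h0, h⟩) | ⟨h0, h⟩) | ⟨h0, h⟩) | h
  · filter_upwards [sepS_ev _ _ _ _ h] with q hq
    rintro x ⟨hx, hy⟩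
    simp only at h0 hx hy hq ⊢
    subst h0
    have := hq x hx hy
    exact ⟨Or.inl this, Or.inl this⟩
  · filter_upwards [sepS_ev _ _ _ _ h] with q hq
    rintro x ⟨hx, hy⟩
    simp only at h0 hx hy hq ⊢
    subst h0
    rw [segment_symm] at hy
    have := hq x hx hy
    exact ⟨Or.inl this, Or.inr this⟩
  · filter_upwards [sepS_ev _ _ _ _ h] with q hq
    rintro x ⟨hx, hy⟩
    simp only at h0 hx hy hq ⊢
    subst h0
    rw [segment_symm] at hx
    have := hq x hx hy
    exact ⟨Or.inr this, Or.inl this⟩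
  · filter_upwards [sepS_ev _ _ _ _ h] with q hq
    rintro x ⟨hx, hy⟩
    simp only at h0 hx hy hq ⊢
    subst h0
    rw [segment_symm] at hx hy
    have := hq x hx hy
    exact ⟨Or.inr this, Or.inr this⟩
  · filter_upwards [sepD_ev _ _ _ _ _ h] with q hq
    rintro x ⟨hx, hy⟩
    exact (hq x hx hy).elim

theorem ev_good : ∀ᶠ q in 𝓝[>] (0 : ℝ), ∀ e ∈ E, ∀ f ∈ E, e ≠ f → Good q e f := by
  rw [eventually_all_finset]
  intro e he
  rw [eventually_all_finset]
  intro f hf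
  by_cases h : e = f
  · exact Eventually.of_forall fun q h' => absurd h h'
  · rcases chk_all e (List.mem_toFinset.1 he) f (List.mem_toFinset.1 hf) h with h | h
    · filter_upwards [chk_good e f h] with q hq _ using hq
    · filter_upwards [chk_good f e h] with q hq _ x hx
      exact (hq x hx.symm).symm

theorem ev_inj : ∀ᶠ q in 𝓝[>] (0 : ℝ), Function.Injective (P q) := by
  have : ∀ᶠ q in 𝓝[>] (0 : ℝ), ∀ i j : Fin 27, i ≠ j → 0 < ev (nf i j) q := by
    rw [eventually_all]
    intro i
    rw [eventually_all]
    intro j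
    by_cases h : i = j
    · exact Eventually.of_forall fun q h' => absurd h h'
    · filter_upwards [ev_pos _ (inj_all i j h)] with q hq _ using hq
  filter_upwards [this] with q hq i j hij
  by_contra hne
  have h1 := dist_P q i j
  rw [hij, dist_self] at h1
  have : 0 < √(ev (nf i j) q) / (1 + q + q ^ 2) := div_pos (Real.sqrt_pos.2 (hq i j hne)) (N_pos q)
  linarith

noncomputable def T (q : ℝ) : ℝ := √(ev [1, 5, 9, 8, 4] q) / (1 + q + q ^ 2)

theorem T_gt : ∀ᶠ q in 𝓝[>] (0 : ℝ), 1 < T q := by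
  filter_upwards [self_mem_nhdsWithin] with q hq
  have hq : (0 : ℝ) < q := hq
  rw [T, lt_div_iff₀ (N_pos q), one_mul]
  apply Real.lt_sqrt_of_sq_lt
  simp only [ev]
  push_cast
  have h : 0 < 3 * q + 6 * q ^ 2 + 6 * q ^ 3 + 3 * q ^ 4 := by positivity
  nlinarith [h]

theorem T_lt (ε : ℝ) (hε : 0 < ε) : ∀ᶠ q in 𝓝[>] (0 : ℝ), T q < 1 + ε := by
  have hc : Continuous T := by
    refine Continuous.div (ev_continuous _).sqrt (by fun_prop) fun q => (N_pos q).ne'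
  have h0 : T 0 < 1 + ε := by simp [T, ev, hε]
  exact ((hc.tendsto 0).eventually (gt_mem_nhds h0)).filter_mono nhdsWithin_le_nhds

theorem dist_unit (q : ℝ) (e : Fin 27 × Fin 27) (h : isU e = true) :
    dist (P q e.1) (P q e.2) = 1 := by
  rw [isU, decide_eq_true_eq] at h
  rw [dist_P, h]
  have : ev [1, 2, 3, 2, 1] q = (1 + q + q ^ 2) ^ 2 := by simp only [ev]; push_cast; ring
  rw [this, Real.sqrt_sq (N_pos q).le, div_self (N_pos q).ne']

theorem dist_cases (q : ℝ) (e : Fin 27 × Fin 27) (he : e ∈ E) :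
    isU e = true ∨ dist (P q e.1) (P q e.2) = T q := by
  rcases E_len e (List.mem_toFinset.1 he) with h | h
  · exact Or.inl h
  · right; rw [dist_P, h, T]

end EpsGraph

open scoped Classical

theorem epsilon_graph_27_exists (ε : ℝ) (hε : 0 < ε) :
    ∃ (P : Fin 27 → EuclideanSpace ℝ (Fin 2)) (E : Finset (Fin 27 × Fin 27)),
      Function.Injective P ∧
      (∀ e ∈ E, e.1 < e.2) ∧
      E.card = 54 ∧
      (∀ v : Fin 27, (E.filter (fun e => e.1 = v ∨ e.2 = v)).card = 4) ∧
      (∀ e ∈ E, ∀ f ∈ E, e ≠ f →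
        ∀ x ∈ segment ℝ (P e.1) (P e.2) ∩ segment ℝ (P f.1) (P f.2),
          (x = P e.1 ∨ x = P e.2) ∧ (x = P f.1 ∨ x = P f.2)) ∧
      (E.filter (fun e => dist (P e.1) (P e.2) = 1)).card = 48 ∧
      (∃ t : ℝ, 1 < t ∧ t < 1 + ε ∧
        ∀ e ∈ E, dist (P e.1) (P e.2) = 1 ∨ dist (P e.1) (P e.2) = t) := by
  obtain ⟨q, h1, h2, h3, h4⟩ := (EpsGraph.ev_inj.and (EpsGraph.ev_good.and
    (EpsGraph.T_gt.and (EpsGraph.T_lt ε hε)))).exists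
  refine ⟨EpsGraph.P q, EpsGraph.E, h1, EpsGraph.E_lt, EpsGraph.E_card, fun v => ?_, h2, ?_,
    EpsGraph.T q, h3, h4, fun e he => ?_⟩
  · convert EpsGraph.E_deg v
  · rw [← EpsGraph.E_unit]
    congr 1
    ext e
    simp only [Finset.mem_filter, and_congr_right_iff]
    intro he
    constructor
    · intro hd
      rcases EpsGraph.dist_cases q e he with h | h
      · exact h
      · rw [hd] at h; exact absurd h h3.ne
    · exact EpsGraph.dist_unit q e
  · rcases EpsGraph.dist_cases q e he with h | h
    · exact Or.inl (EpsGraph.dist_unit q e h)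
    · exact Or.inr h
end
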